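/- (Existence of a critical point of the truncated functional, Theorem 3.2, weak formulation.) Let N > 2, 2* = 2N/(N−2), 4 < θ < 2·2*, k > θ/(θ−2), α > 0, β = (α/k)^{1/(2(2*−1))}. Let 0 < R₁ < r₁ < r₂ < R₂, Ω = {x ∈ ℝᴺ : r₁ < |x| < r₂}, Λ = {x ∈ ℝᴺ : R₁ < |x| < R₂}, and let V : ℝᴺ → ℝ be continuous, radially symmetric, with V ≥ 0, V = 0 on Ω, and V(x) ≥ α for x ∉ Λ. Then there exists a radially symmetric measurable function v : ℝᴺ → ℝ, not almost everywhere zero, possessing a weak gradient ∇v ∈ L²(ℝᴺ; ℝᴺ) (i.e. ∫ v ∂ᵢφ dx = −∫ (∇v)ᵢ φ dx for all smooth compactly supported φ and all i) with ∫_{ℝᴺ} V(x) f(v)² dx < ∞, such that for every smooth compactly supported function φ : ℝᴺ → ℝ, ∫ ∇v·∇φ dx + ∫ V(x) f(v) f'(v) φ dx − ∫ w(x, f(v)) f'(v) φ dx = 0. -/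

import Mathlib

open MeasureTheory
open scoped Classical

/-- The function `h(u) = (1/2)·u·√(1+u²) + (1/2)·log(u + √(1+u²))`. -/
noncomputable def h (u : ℝ) : ℝ :=
  (1/2) * u * Real.sqrt (1 + u^2) + (1/2) * Real.log (u + Real.sqrt (1 + u^2))

section AbstractPart
open Set Filter Topology

/-- Hypotheses of the abstract variational problem. -/
structure VarHyp {H : Type*} [NormedAddCommGroup H] [InnerProductSpace ℝ H]
    {X : Type*} [MeasurableSpace X] (μ : Measure X) (S : Set X) (k : X → H)
    (F F' : X → ℝ → ℝ) (D : X → ℝ) (B : ℝ) : Prop where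
  hS : MeasurableSet S
  hSfin : μ S ≠ ⊤
  hk : ∀ u : H, Measurable fun x => inner ℝ u (k x)
  hB0 : 0 ≤ B
  hB : ∀ x ∈ S, ‖k x‖ ≤ B
  hFm : Measurable (Function.uncurry F)
  hder : ∀ x s, HasDerivAt (F x) (F' x s) s
  hcont : ∀ x, Continuous (F' x)
  hF0 : ∀ x, F x 0 = 0
  hout : ∀ x, x ∉ S → ∀ s, 0 ≤ F x s
  hneg : ∀ x, ∀ s, s ≤ 0 → 0 ≤ F x s
  hconc : ∀ x s, ConcaveOn ℝ (Ici (0:ℝ)) (fun τ => F x (√τ * s))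
  hstrict : ∀ x ∈ S, ∀ s, 0 < s → StrictConcaveOn ℝ (Ici (0:ℝ)) (fun τ => F x (√τ * s))
  hbd : ∀ M : ℝ, ∃ C : ℝ, ∀ x ∈ S, ∀ s, |s| ≤ M → |F x s| ≤ C ∧ |F' x s| ≤ C
  hD : ∀ x, x ∉ S → ∀ s, |F' x s| ≤ D x
  hsup : ∀ K : ℝ, ∃ s₀ : ℝ, ∀ x ∈ S, ∀ s, s₀ ≤ s → F x s ≤ -K * s ^ 2
  hsub : ∀ ε : ℝ, 0 < ε → ∃ δ : ℝ, 0 < δ ∧ ∀ x ∈ S, ∀ s, |s| ≤ δ → -ε * s ^ 2 ≤ F x s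

namespace VarHyp

variable {H : Type*} [NormedAddCommGroup H] [InnerProductSpace ℝ H]
    {X : Type*} [MeasurableSpace X] {μ : Measure X} {S : Set X} {k : X → H}
    {F F' : X → ℝ → ℝ} {D : X → ℝ} {B : ℝ}

lemma contF (hy : VarHyp μ S k F F' D B) (x : X) : Continuous (F x) :=
  continuous_iff_continuousAt.2 fun s => (hy.hder x s).continuousAt

lemma measF (hy : VarHyp μ S k F F' D B) {v : X → ℝ} (hv : Measurable v) :
    Measurable fun x => F x (v x) :=
  hy.hFm.comp (measurable_id.prodMk hv)

lemma conc_ineq (hy : VarHyp μ S k F F' D B) (x : X) (s p q a b : ℝ) (hp : 0 ≤ p) (hq : 0 ≤ q)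
    (ha : 0 ≤ a) (hb : 0 ≤ b) (hab : a + b = 1) :
    a * F x (√p * s) + b * F x (√q * s) ≤ F x (√(a * p + b * q) * s) :=
  (hy.hconc x s).2 (mem_Ici.2 hp) (mem_Ici.2 hq) ha hb hab

/-- concavity with value zero at zero -/
lemma scale_ge_one (hy : VarHyp μ S k F F' D B) (x : X) (s t : ℝ) (ht : 1 ≤ t) :
    F x (t * s) ≤ t ^ 2 * F x s := by
  have hc := hy.conc_ineq x s 0 (t ^ 2) (1 - 1 / t ^ 2) (1 / t ^ 2) le_rfl (by positivity)
    (by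
      rw [sub_nonneg, div_le_one (by positivity)]; nlinarith) (by positivity) (by ring)
  have ht0 : (0:ℝ) < t ^ 2 := by positivity
  have e1 : (1 - 1 / t ^ 2) * 0 + 1 / t ^ 2 * t ^ 2 = 1 := by field_simp; ring
  rw [e1] at hc
  simp only [Real.sqrt_zero, zero_mul, hy.hF0, mul_zero, Real.sqrt_one, one_mul,
    zero_add, Real.sqrt_sq (by linarith : (0:ℝ) ≤ t)] at hc
  rw [one_div, inv_mul_le_iff₀ ht0] at hc
  exact hc

lemma scale_le_one (hy : VarHyp μ S k F F' D B) (x : X) (hx : x ∉ S) (s t : ℝ) (h0 : 0 ≤ t)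
    (ht : t ≤ 1) : F x (t * s) ≤ F x s := by
  by_contra hcon
  push Not at hcon
  rcases eq_or_lt_of_le ht with h1 | h1
  · subst h1; simp at hcon
  set a := t ^ 2 with ha
  have ha1 : a < 1 := by rw [ha]; nlinarith
  have ha0 : 0 ≤ a := by positivity
  have hF1 := hy.hout x hx s
  set P := F x (t * s)
  set Q := F x s
  set b := 1 + ((1 - a) * Q + 1) / (P - Q) with hb
  have hPQ : 0 < P - Q := by linarith
  have hb1 : 1 < b := by
    rw [hb]
    have : 0 < ((1 - a) * Q + 1) / (P - Q) := by
      apply div_pos _ hPQ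
      have := mul_nonneg (by linarith : 0 ≤ 1 - a) hF1
      linarith
    linarith
  have hba : 0 < b - a := by linarith
  have hc := hy.conc_ineq x s a b ((b - 1) / (b - a)) ((1 - a) / (b - a)) ha0 (by linarith)
    (div_nonneg (by linarith) hba.le) (div_nonneg (by linarith) hba.le)
    (by field_simp; ring)
  have e1 : (b - 1) / (b - a) * a + (1 - a) / (b - a) * b = 1 := by field_simp; ring
  simp only [e1, Real.sqrt_one, one_mul] at hc
  rw [show √a = t by rw [ha, Real.sqrt_sq h0]] at hc
  change _ * P + _ ≤ Q at hc
  have h2 : 0 ≤ (1 - a) / (b - a) * F x (√b * s) :=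
    mul_nonneg (div_nonneg (by linarith) hba.le) (hy.hout x hx _)
  have h3 : (b - 1) / (b - a) * P ≤ Q := by linarith
  rw [div_mul_eq_mul_div, div_le_iff₀ hba] at h3
  have h4 : (b - 1) * (P - Q) = (1 - a) * Q + 1 := by rw [hb]; field_simp; ring
  nlinarith

lemma v_bd (hy : VarHyp μ S k F F' D B) (u : H) {x : X} (hx : x ∈ S) :
    |inner ℝ u (k x)| ≤ B * ‖u‖ := by
  refine (abs_real_inner_le_norm _ _).trans ?_
  rw [mul_comm]
  exact mul_le_mul_of_nonneg_right (hy.hB x hx) (norm_nonneg _)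

/-- integrable dominating function for scalings -/
lemma dom (hy : VarHyp μ S k F F' D B) (u : H)
    (hu : Integrable (fun x => F x (inner ℝ u (k x))) μ) (b : ℝ) (hb : 0 ≤ b) :
    ∃ G : X → ℝ, Integrable G μ ∧ ∀ t ∈ Icc (0:ℝ) b, ∀ x, |F x (t * inner ℝ u (k x))| ≤ G x := by
  obtain ⟨C, hC⟩ := hy.hbd (b * (B * ‖u‖))
  refine ⟨fun x => S.indicator (fun _ => |C|) x + max 1 (b ^ 2) * |F x (inner ℝ u (k x))|, ?_, ?_⟩
  · refine Integrable.add ?_ (hu.abs.const_mul _)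
    rw [integrable_indicator_iff hy.hS]
    exact integrableOn_const hy.hSfin
  · intro t ht x
    by_cases hx : x ∈ S
    · have h1 : |t * inner ℝ u (k x)| ≤ b * (B * ‖u‖) := by
        rw [abs_mul, abs_of_nonneg ht.1]
        exact mul_le_mul ht.2 (hy.v_bd u hx) (abs_nonneg _) hb
      have h2 := (hC x hx _ h1).1
      have h3 : 0 ≤ max 1 (b ^ 2) * |F x (inner ℝ u (k x))| := by positivity
      simp only [hx, indicator_of_mem]
      linarith [le_abs_self C]
    · simp only [hx, not_false_eq_true, indicator_of_notMem, zero_add]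
      have h0 := hy.hout x hx
      rw [abs_of_nonneg (h0 _), abs_of_nonneg (h0 _)]
      rcases le_total t 1 with h1 | h1
      · refine (hy.scale_le_one x hx _ t ht.1 h1).trans ?_
        exact le_mul_of_one_le_left (h0 _) (le_max_left _ _)
      · refine (hy.scale_ge_one x _ t h1).trans ?_
        refine mul_le_mul_of_nonneg_right ?_ (h0 _)
        refine le_trans ?_ (le_max_right _ _)
        have := ht.2
        gcongr

lemma int_scale (hy : VarHyp μ S k F F' D B) (u : H)
    (hu : Integrable (fun x => F x (inner ℝ u (k x))) μ) (t : ℝ) (ht : 0 ≤ t) :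
    Integrable (fun x => F x (t * inner ℝ u (k x))) μ := by
  obtain ⟨G, hG, hd⟩ := hy.dom u hu t ht
  refine hG.mono' (hy.measF ((hy.hk u).const_mul t)).aestronglyMeasurable ?_
  exact Eventually.of_forall fun x => hd t ⟨ht, le_rfl⟩ x

end VarHyp

/-- the functional along the ray through `u` -/
noncomputable def rayJ {H : Type*} [NormedAddCommGroup H] [InnerProductSpace ℝ H]
    {X : Type*} [MeasurableSpace X] (μ : Measure X) (k : X → H)
    (F : X → ℝ → ℝ) (u : H) (t : ℝ) : ℝ :=
  t ^ 2 * ‖u‖ ^ 2 / 2 + ∫ x, F x (t * inner ℝ u (k x)) ∂μ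

namespace VarHyp

variable {H : Type*} [NormedAddCommGroup H] [InnerProductSpace ℝ H]
    {X : Type*} [MeasurableSpace X] {μ : Measure X} {S : Set X} {k : X → H}
    {F F' : X → ℝ → ℝ} {D : X → ℝ} {B : ℝ}

lemma rayJ_smul (u : H) (a t : ℝ) : rayJ μ k F (a • u) t = rayJ μ k F u (t * a) := by
  simp only [rayJ, norm_smul, inner_smul_left, Real.norm_eq_abs, mul_pow, sq_abs]
  congr 1
  · ring
  · simp [mul_assoc]

lemma rayJ_cont (hy : VarHyp μ S k F F' D B) (u : H)
    (hu : Integrable (fun x => F x (inner ℝ u (k x))) μ) (b : ℝ) (hb : 0 ≤ b) :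
    ContinuousOn (rayJ μ k F u) (Icc 0 b) := by
  obtain ⟨G, hG, hd⟩ := hy.dom u hu b hb
  refine ContinuousOn.add (by fun_prop) ?_
  refine continuousOn_of_dominated (bound := G) ?_ ?_ hG ?_
  · intro t _
    exact (hy.measF ((hy.hk u).const_mul t)).aestronglyMeasurable
  · intro t ht
    exact Eventually.of_forall fun x => hd t ht x
  · refine Eventually.of_forall fun x => Continuous.continuousOn ?_
    exact (hy.contF x).comp (by fun_prop)

lemma rayJ_zero (hy : VarHyp μ S k F F' D B) (u : H) : rayJ μ k F u 0 = 0 := by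
  simp [rayJ, hy.hF0]

lemma ray_neg (hy : VarHyp μ S k F F' D B) (u : H)
    (hu : Integrable (fun x => F x (inner ℝ u (k x))) μ)
    (hpos : μ {x | x ∈ S ∧ 0 < inner ℝ u (k x)} ≠ 0) :
    ∃ T : ℝ, 0 < T ∧ ∀ t, T ≤ t → rayJ μ k F u t ≤ 0 := by
  have hm := hy.hk u
  obtain ⟨n, hn⟩ : ∃ n : ℕ, μ {x | x ∈ S ∧ 1 / ((n:ℝ) + 1) ≤ inner ℝ u (k x)} ≠ 0 := by
    by_contra hcon
    push Not at hcon
    apply hpos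
    refine measure_mono_null ?_ (measure_iUnion_null hcon)
    rintro x ⟨hx, hx'⟩
    obtain ⟨n, hn⟩ := exists_nat_one_div_lt hx'
    exact mem_iUnion.2 ⟨n, hx, hn.le⟩
  set δ : ℝ := 1 / ((n:ℝ) + 1)
  have hδ : 0 < δ := by positivity
  set Sd := {x | x ∈ S ∧ δ ≤ inner ℝ u (k x)} with hSd
  have hSdm : MeasurableSet Sd := hy.hS.inter (measurableSet_le measurable_const hm)
  have hSdfin : μ Sd ≠ ⊤ := ne_top_of_le_ne_top hy.hSfin (measure_mono fun x hx => hx.1)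
  have hSdpos : 0 < μ.real Sd := ENNReal.toReal_pos hn hSdfin
  set K : ℝ := (‖u‖ ^ 2 / 2 + ∫ x, |F x (inner ℝ u (k x))| ∂μ) / (δ ^ 2 * μ.real Sd) with hK
  have hint0 : 0 ≤ ∫ x, |F x (inner ℝ u (k x))| ∂μ := integral_nonneg fun x => abs_nonneg _
  have hK0 : 0 ≤ K := by positivity
  obtain ⟨s₀, hs₀⟩ := hy.hsup K
  refine ⟨max 1 (s₀ / δ), by positivity, ?_⟩
  intro t ht
  have ht1 : 1 ≤ t := (le_max_left _ _).trans ht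
  have ht2 : s₀ ≤ t * δ := by
    have := (le_max_right _ _).trans ht
    rwa [div_le_iff₀ hδ] at this
  have hbound : ∀ x, F x (t * inner ℝ u (k x)) ≤
      t ^ 2 * |F x (inner ℝ u (k x))| + Sd.indicator (fun _ => -K * t ^ 2 * δ ^ 2) x := by
    intro x
    by_cases hx : x ∈ Sd
    · simp only [hx, indicator_of_mem]
      have h1 : t * δ ≤ t * inner ℝ u (k x) := by
        have := hx.2
        gcongr
      have h2 := hs₀ x hx.1 _ (ht2.trans h1)
      have h3 : (t * δ) ^ 2 ≤ (t * inner ℝ u (k x)) ^ 2 := by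
        have : 0 ≤ t * δ := by positivity
        gcongr
      have h4 := mul_le_mul_of_nonneg_left h3 hK0
      have h5 : 0 ≤ t ^ 2 * |F x (inner ℝ u (k x))| := by positivity
      nlinarith
    · simp only [hx, not_false_eq_true, indicator_of_notMem, add_zero]
      refine (hy.scale_ge_one x _ t ht1).trans ?_
      exact mul_le_mul_of_nonneg_left (le_abs_self _) (by positivity)
  have hi2 : Integrable (Sd.indicator (fun _ : X => -K * t ^ 2 * δ ^ 2)) μ := by
    rw [integrable_indicator_iff hSdm]
    exact integrableOn_const hSdfin
  have hle := integral_mono (hy.int_scale u hu t (by linarith))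
    ((hu.abs.const_mul (t ^ 2)).add hi2) hbound
  have heq : ∫ x, (t ^ 2 * |F x (inner ℝ u (k x))| + Sd.indicator (fun _ => -K * t ^ 2 * δ ^ 2) x) ∂μ
      = t ^ 2 * ∫ x, |F x (inner ℝ u (k x))| ∂μ + μ.real Sd * (-K * t ^ 2 * δ ^ 2) := by
    rw [integral_add (hu.abs.const_mul _) hi2, integral_const_mul, integral_indicator hSdm,
      setIntegral_const, smul_eq_mul]
  have hKeq : K * (δ ^ 2 * μ.real Sd) = ‖u‖ ^ 2 / 2 + ∫ x, |F x (inner ℝ u (k x))| ∂μ := by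
    rw [hK]; field_simp
  simp only [Pi.add_apply] at hle
  rw [heq] at hle
  rw [rayJ]
  nlinarith

lemma ray_pos (hy : VarHyp μ S k F F' D B) (u : H) (hu0 : u ≠ 0)
    (hu : Integrable (fun x => F x (inner ℝ u (k x))) μ) :
    ∃ t : ℝ, 0 < t ∧ 0 < rayJ μ k F u t := by
  have hnu : 0 < ‖u‖ := norm_pos_iff.2 hu0
  have hμ : 0 ≤ μ.real S := measureReal_nonneg
  have hB0 := hy.hB0
  set ε : ℝ := 1 / (4 * (B ^ 2 * μ.real S + 1)) with hε
  have hε0 : 0 < ε := by positivity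
  obtain ⟨δ, hδ, hd⟩ := hy.hsub ε hε0
  set t : ℝ := δ / (B * ‖u‖ + 1) with ht
  have ht0 : 0 < t := by positivity
  refine ⟨t, ht0, ?_⟩
  have htB : t * (B * ‖u‖) ≤ δ := by
    rw [ht, div_mul_eq_mul_div, div_le_iff₀ (by positivity)]
    nlinarith
  have hbound : ∀ x, S.indicator (fun _ => -ε * (t * (B * ‖u‖)) ^ 2) x ≤
      F x (t * inner ℝ u (k x)) := by
    intro x
    by_cases hx : x ∈ S
    · simp only [hx, indicator_of_mem]
      have h1 : |t * inner ℝ u (k x)| ≤ t * (B * ‖u‖) := by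
        rw [abs_mul, abs_of_pos ht0]
        exact mul_le_mul_of_nonneg_left (hy.v_bd u hx) ht0.le
      have h2 := hd x hx _ (h1.trans htB)
      have h3 : (t * inner ℝ u (k x)) ^ 2 ≤ (t * (B * ‖u‖)) ^ 2 := by
        rw [← sq_abs (t * inner ℝ u (k x))]; gcongr
      nlinarith
    · simp only [hx, not_false_eq_true, indicator_of_notMem]
      exact hy.hout x hx _
  have hi2 : Integrable (S.indicator (fun _ : X => -ε * (t * (B * ‖u‖)) ^ 2)) μ := by
    rw [integrable_indicator_iff hy.hS]
    exact integrableOn_const hy.hSfin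
  have hle := integral_mono hi2 (hy.int_scale u hu t ht0.le) hbound
  rw [integral_indicator hy.hS, setIntegral_const, smul_eq_mul] at hle
  rw [rayJ]
  have h5 : ε * (B ^ 2 * μ.real S) ≤ 1 / 4 := by
    rw [hε, div_mul_eq_mul_div, div_le_iff₀ (by positivity)]
    nlinarith
  have h6 : 0 < t ^ 2 * ‖u‖ ^ 2 := by positivity
  have h7 := mul_le_mul_of_nonneg_left h5 h6.le
  nlinarith

lemma ray_unbdd (hy : VarHyp μ S k F F' D B) (u : H) (hu0 : u ≠ 0)
    (m : ℝ) (hm : ∀ t, 0 ≤ t → rayJ μ k F u t ≤ m) :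
    μ {x | x ∈ S ∧ 0 < inner ℝ u (k x)} ≠ 0 := by
  intro h0
  have hnu : 0 < ‖u‖ := norm_pos_iff.2 hu0
  have key : ∀ t, 0 ≤ t → t ^ 2 * ‖u‖ ^ 2 / 2 ≤ m := by
    intro t ht
    refine le_trans ?_ (hm t ht)
    rw [rayJ]
    have : 0 ≤ ∫ x, F x (t * inner ℝ u (k x)) ∂μ := by
      apply integral_nonneg_of_ae
      have : ∀ᵐ x ∂μ, ¬ (x ∈ S ∧ 0 < inner ℝ u (k x)) := by
        rw [ae_iff]; simpa using h0
      filter_upwards [this] with x hx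
      by_cases hxS : x ∈ S
      · apply hy.hneg
        have : inner ℝ u (k x) ≤ 0 := by
          by_contra hc; exact hx ⟨hxS, not_le.1 hc⟩
        exact mul_nonpos_of_nonneg_of_nonpos ht this
      · exact hy.hout x hxS _
    linarith
  have hm0 : 0 ≤ m := by simpa using key 0 le_rfl
  have := key ((2 * m + 2) / ‖u‖) (by positivity)
  rw [div_pow, div_mul_cancel₀ _ (by positivity)] at this
  nlinarith

lemma ray_max (hy : VarHyp μ S k F F' D B) (u : H) (hu0 : u ≠ 0)
    (hu : Integrable (fun x => F x (inner ℝ u (k x))) μ)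
    (hpos : μ {x | x ∈ S ∧ 0 < inner ℝ u (k x)} ≠ 0) :
    ∃ t₀ : ℝ, 0 < t₀ ∧ ∀ t, 0 ≤ t → rayJ μ k F u t ≤ rayJ μ k F u t₀ := by
  obtain ⟨T, hT, hneg⟩ := hy.ray_neg u hu hpos
  obtain ⟨s, hs, hJs⟩ := hy.ray_pos u hu0 hu
  have hsT : s ≤ T := by
    by_contra hc
    exact absurd (hneg s (not_le.1 hc).le) (not_le.2 hJs)
  obtain ⟨t₀, ht₀, hmax⟩ := isCompact_Icc.exists_isMaxOn ⟨s, hs.le, hsT⟩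
    (hy.rayJ_cont u hu T hT.le)
  have hp : 0 < rayJ μ k F u t₀ := hJs.trans_le (hmax ⟨hs.le, hsT⟩)
  refine ⟨t₀, lt_of_le_of_ne ht₀.1 ?_, ?_⟩
  · rintro rfl
    rw [hy.rayJ_zero] at hp
    exact lt_irrefl _ hp
  · intro t ht
    rcases le_total t T with h1 | h1
    · exact hmax ⟨ht, h1⟩
    · exact (hneg t h1).trans hp.le

end VarHyp
end AbstractPart

section AbstractPart2
open Set Filter Topology

lemma weak_seq_compact {H : Type*} [NormedAddCommGroup H] [InnerProductSpace ℝ H]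
    [CompleteSpace H] [TopologicalSpace.SeparableSpace H] (u : ℕ → H) (hu : ∀ n, ‖u n‖ ≤ 1) :
    ∃ (a : H) (φ : ℕ → ℕ), ‖a‖ ≤ 1 ∧ StrictMono φ ∧
      ∀ w, Tendsto (fun n => inner ℝ (u (φ n)) w) atTop (𝓝 (inner ℝ a w)) := by
  have hc := WeakDual.isSeqCompact_closedBall (𝕜 := ℝ) (E := H) 0 1
  let x : ℕ → WeakDual ℝ H := fun n => StrongDual.toWeakDual (InnerProductSpace.toDual ℝ H (u n))
  have hx : ∀ n, x n ∈ (WeakDual.toStrongDual ⁻¹' Metric.closedBall (0 : StrongDual ℝ H) 1) := by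
    intro n
    simp only [mem_preimage, mem_closedBall_zero_iff]
    change ‖InnerProductSpace.toDual ℝ H (u n)‖ ≤ 1
    simpa using hu n
  obtain ⟨b, hb, φ, hφ, hlim⟩ := hc hx
  set b' : StrongDual ℝ H := WeakDual.toStrongDual b with hb'
  refine ⟨(InnerProductSpace.toDual ℝ H).symm b', φ, ?_, hφ, ?_⟩
  · rw [LinearIsometryEquiv.norm_map]
    simpa using hb
  · intro w
    rw [InnerProductSpace.toDual_symm_apply]
    have := ((WeakDual.eval_continuous w).tendsto b).comp hlim
    exact this

namespace VarHyp

variable {H : Type*} [NormedAddCommGroup H] [InnerProductSpace ℝ H]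
    {X : Type*} [MeasurableSpace X] {μ : Measure X} {S : Set X} {k : X → H}
    {F F' : X → ℝ → ℝ} {D : X → ℝ} {B : ℝ}

/-- Fatou step. -/
lemma fatou_step (hy : VarHyp μ S k F F' D B) (u : ℕ → H) (a : H) (hu : ∀ n, ‖u n‖ ≤ 1)
    (hlim : ∀ w, Tendsto (fun n => inner ℝ (u n) w) atTop (𝓝 (inner ℝ a w)))
    (t : ℝ) (ht : 0 ≤ t) (m : ℕ → ℝ) (c : ℝ) (hm : Tendsto m atTop (𝓝 c))
    (hintg : ∀ n, Integrable (fun x => F x (t * inner ℝ (u n) (k x))) μ)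
    (hle : ∀ n, ∫ x, F x (t * inner ℝ (u n) (k x)) ∂μ ≤ m n) :
    Integrable (fun x => F x (t * inner ℝ a (k x))) μ ∧
      ∫ x, F x (t * inner ℝ a (k x)) ∂μ ≤ c := by
  obtain ⟨C, hC⟩ := hy.hbd (t * B)
  have hi : Integrable (S.indicator (fun _ : X => |C|)) μ := by
    rw [integrable_indicator_iff hy.hS]
    exact integrableOn_const hy.hSfin
  set I0 := ∫ x, S.indicator (fun _ : X => |C|) x ∂μ with hI0
  have hnn : ∀ n x, 0 ≤ F x (t * inner ℝ (u n) (k x)) + S.indicator (fun _ : X => |C|) x := by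
    intro n x
    by_cases hx : x ∈ S
    · simp only [hx, indicator_of_mem]
      have h1 : |t * inner ℝ (u n) (k x)| ≤ t * B := by
        rw [abs_mul, abs_of_nonneg ht]
        refine mul_le_mul_of_nonneg_left ((hy.v_bd (u n) hx).trans ?_) ht
        exact mul_le_of_le_one_right hy.hB0 (hu n)
      have h2 := (hC x hx _ h1).1
      have := neg_abs_le (F x (t * inner ℝ (u n) (k x)))
      linarith [le_abs_self C]
    · simp only [hx, not_false_eq_true, indicator_of_notMem, add_zero]
      exact hy.hout x hx _
  have hpt : ∀ x, Tendsto (fun n => F x (t * inner ℝ (u n) (k x)) + S.indicator (fun _ : X => |C|) x)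
      atTop (𝓝 (F x (t * inner ℝ a (k x)) + S.indicator (fun _ : X => |C|) x)) := by
    intro x
    exact (((hy.contF x).tendsto _).comp ((hlim (k x)).const_mul t)).add_const _
  have hnn' : ∀ x, 0 ≤ F x (t * inner ℝ a (k x)) + S.indicator (fun _ : X => |C|) x := fun x =>
    ge_of_tendsto (hpt x) (Eventually.of_forall fun n => hnn n x)
  have hmeas : ∀ w : H, Measurable fun x => F x (t * inner ℝ w (k x)) :=
    fun w => hy.measF ((hy.hk w).const_mul t)
  have hmi : Measurable (S.indicator (fun _ : X => |C|)) := measurable_const.indicator hy.hS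
  have hfat : ∫⁻ x, ENNReal.ofReal (F x (t * inner ℝ a (k x)) + S.indicator (fun _ : X => |C|) x) ∂μ
      ≤ ENNReal.ofReal (c + I0) := by
    calc _ = ∫⁻ x, liminf (fun n => ENNReal.ofReal
            (F x (t * inner ℝ (u n) (k x)) + S.indicator (fun _ : X => |C|) x)) atTop ∂μ := by
          refine lintegral_congr fun x => ?_
          exact ((ENNReal.continuous_ofReal.tendsto _).comp (hpt x)).liminf_eq.symm
      _ ≤ liminf (fun n => ∫⁻ x, ENNReal.ofReal
            (F x (t * inner ℝ (u n) (k x)) + S.indicator (fun _ : X => |C|) x) ∂μ) atTop :=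
          lintegral_liminf_le fun n => ((hmeas (u n)).add hmi).ennreal_ofReal
      _ ≤ liminf (fun n => ENNReal.ofReal (m n + I0)) atTop := by
          refine liminf_le_liminf (Eventually.of_forall fun n => ?_)
          change _ ≤ ENNReal.ofReal (m n + I0)
          have hs : Integrable (fun x => F x (t * inner ℝ (u n) (k x)) +
              S.indicator (fun _ : X => |C|) x) μ := (hintg n).add hi
          rw [← ofReal_integral_eq_lintegral_ofReal hs
            (Eventually.of_forall fun x => hnn n x), integral_add (hintg n) hi]
          exact ENNReal.ofReal_le_ofReal (by have := hle n; linarith)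
      _ = ENNReal.ofReal (c + I0) :=
          ((ENNReal.continuous_ofReal.tendsto _).comp (hm.add_const I0)).liminf_eq
  have hint2 : Integrable
      (fun x => F x (t * inner ℝ a (k x)) + S.indicator (fun _ : X => |C|) x) μ := by
    refine ⟨((hmeas a).add hmi).aestronglyMeasurable, ?_⟩
    rw [hasFiniteIntegral_iff_ofReal (Eventually.of_forall hnn')]
    exact hfat.trans_lt ENNReal.ofReal_lt_top
  have hint3 : Integrable (fun x => F x (t * inner ℝ a (k x))) μ := by
    have := hint2.sub hi
    refine this.congr (Eventually.of_forall fun x => ?_)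
    simp
  refine ⟨hint3, ?_⟩
  rw [← ofReal_integral_eq_lintegral_ofReal hint2 (Eventually.of_forall hnn'),
    integral_add hint3 hi] at hfat
  have hcI : 0 ≤ c + I0 := by
    refine ge_of_tendsto (hm.add_const I0) (Eventually.of_forall fun n => ?_)
    have h1 : 0 ≤ ∫ x, (F x (t * inner ℝ (u n) (k x)) + S.indicator (fun _ : X => |C|) x) ∂μ :=
      integral_nonneg (hnn n)
    rw [integral_add (hintg n) hi] at h1
    have := hle n
    linarith
  have := (ENNReal.ofReal_le_ofReal_iff hcI).1 hfat
  linarith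

/-- Minimax level is attained. -/
lemma exists_min [CompleteSpace H] [TopologicalSpace.SeparableSpace H]
    (hy : VarHyp μ S k F F' D B) (u₀ : H)
    (hu₀ : Integrable (fun x => F x (inner ℝ u₀ (k x))) μ)
    (hpos : μ {x | x ∈ S ∧ 0 < inner ℝ u₀ (k x)} ≠ 0) :
    ∃ (u : H) (c : ℝ), u ≠ 0 ∧ Integrable (fun x => F x (inner ℝ u (k x))) μ ∧
      μ {x | x ∈ S ∧ 0 < inner ℝ u (k x)} ≠ 0 ∧
      rayJ μ k F u 1 = c ∧ (∀ t, 0 ≤ t → rayJ μ k F u t ≤ c) ∧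
      (∀ u' : H, u' ≠ 0 → Integrable (fun x => F x (inner ℝ u' (k x))) μ →
        ∀ m, (∀ t, 0 ≤ t → rayJ μ k F u' t ≤ m) → c ≤ m) := by
  have hu₀0 : u₀ ≠ 0 := by
    rintro rfl
    apply hpos
    simp
  set A : Set ℝ := {m | ∃ u : H, ‖u‖ = 1 ∧ Integrable (fun x => F x (inner ℝ u (k x))) μ ∧
    ∀ t, 0 ≤ t → rayJ μ k F u t ≤ m} with hA
  have hnorm : ∀ u' : H, u' ≠ 0 → Integrable (fun x => F x (inner ℝ u' (k x))) μ →
        ∀ m, (∀ t, 0 ≤ t → rayJ μ k F u' t ≤ m) → m ∈ A := by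
    intro u' hu' hi m hm
    have hn : 0 < ‖u'‖ := norm_pos_iff.2 hu'
    refine ⟨‖u'‖⁻¹ • u', by rw [norm_smul, norm_inv, norm_norm, inv_mul_cancel₀ hn.ne'], ?_, ?_⟩
    · have := hy.int_scale u' hi ‖u'‖⁻¹ (by positivity)
      simpa [inner_smul_left] using this
    · intro t ht
      rw [rayJ_smul]
      exact hm _ (by positivity)
  have hAne : A.Nonempty := by
    obtain ⟨t₀, _, ht₀⟩ := hy.ray_max u₀ hu₀0 hu₀ hpos
    exact ⟨_, hnorm u₀ hu₀0 hu₀ _ ht₀⟩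
  have hAbdd : BddBelow A := by
    refine ⟨0, ?_⟩
    rintro m ⟨u, -, -, hm⟩
    have := hm 0 le_rfl
    rwa [hy.rayJ_zero] at this
  set c := sInf A with hc
  obtain ⟨m, -, hmlim, hmA⟩ := exists_seq_tendsto_sInf hAne hAbdd
  choose u hu1 hui huJ using hmA
  obtain ⟨a, φ, ha1, hφ, hweak⟩ := weak_seq_compact u fun n => (hu1 n).le
  have hstep : ∀ t, 0 ≤ t → Integrable (fun x => F x (t * inner ℝ a (k x))) μ ∧
      ∫ x, F x (t * inner ℝ a (k x)) ∂μ ≤ c - t ^ 2 / 2 := by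
    intro t ht
    refine hy.fatou_step (fun n => u (φ n)) a (fun n => (hu1 _).le) hweak t ht
      (fun n => m (φ n) - t ^ 2 / 2) _ ((hmlim.comp hφ.tendsto_atTop).sub_const _)
      (fun n => hy.int_scale _ (hui _) t ht) ?_
    intro n
    have := huJ (φ n) t ht
    rw [rayJ, hu1] at this
    linarith
  have ha0 : a ≠ 0 := by
    rintro rfl
    have h1 := fun t ht => (hstep t ht).2
    simp only [inner_zero_left, mul_zero, hy.hF0, integral_zero] at h1
    have h0 := h1 0 le_rfl
    have h2 := h1 (2 * c + 2) (by nlinarith)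
    nlinarith
  have hai : Integrable (fun x => F x (inner ℝ a (k x))) μ := by
    simpa using (hstep 1 zero_le_one).1
  have haJ : ∀ t, 0 ≤ t → rayJ μ k F a t ≤ c := by
    intro t ht
    have := (hstep t ht).2
    rw [rayJ]
    have h1 : ‖a‖ ^ 2 ≤ 1 := by nlinarith [norm_nonneg a]
    have h2 : t ^ 2 * ‖a‖ ^ 2 ≤ t ^ 2 := mul_le_of_le_one_right (by positivity) h1
    linarith
  have hapos := hy.ray_unbdd a ha0 c haJ
  obtain ⟨t₀, ht₀, hmax⟩ := hy.ray_max a ha0 hai hapos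
  have hceq : rayJ μ k F a t₀ = c :=
    le_antisymm (haJ t₀ ht₀.le) (csInf_le hAbdd (hnorm a ha0 hai _ hmax))
  refine ⟨t₀ • a, c, smul_ne_zero ht₀.ne' ha0, ?_, ?_, ?_, ?_, ?_⟩
  · have := hy.int_scale a hai t₀ ht₀.le
    simpa [inner_smul_left] using this
  · simpa [inner_smul_left, ht₀] using hapos
  · rw [rayJ_smul, one_mul, hceq]
  · intro t ht
    rw [rayJ_smul]
    exact haJ _ (by positivity)
  · intro u' hu' hi m hm
    exact csInf_le hAbdd (hnorm u' hu' hi m hm)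

/-- concavity of the functional along rays in the squared parameter -/
lemma ray_concave (hy : VarHyp μ S k F F' D B) (u : H)
    (hu : Integrable (fun x => F x (inner ℝ u (k x))) μ) (p q a b : ℝ) (hp : 0 ≤ p) (hq : 0 ≤ q)
    (ha : 0 ≤ a) (hb : 0 ≤ b) (hab : a + b = 1) :
    a * rayJ μ k F u (√p) + b * rayJ μ k F u (√q) ≤ rayJ μ k F u (√(a * p + b * q)) := by
  have hr : 0 ≤ a * p + b * q := by positivity
  simp only [rayJ, Real.sq_sqrt hp, Real.sq_sqrt hq, Real.sq_sqrt hr]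
  have i1 := hy.int_scale u hu _ (Real.sqrt_nonneg p)
  have i2 := hy.int_scale u hu _ (Real.sqrt_nonneg q)
  have i3 := hy.int_scale u hu _ (Real.sqrt_nonneg (a * p + b * q))
  have := integral_mono ((i1.const_mul a).add (i2.const_mul b)) i3
    (fun x => hy.conc_ineq x _ p q a b hp hq ha hb hab)
  simp only [Pi.add_apply] at this
  rw [integral_add (i1.const_mul a) (i2.const_mul b), integral_const_mul, integral_const_mul] at this
  nlinarith

lemma ray_strict (hy : VarHyp μ S k F F' D B) (u : H)
    (hu : Integrable (fun x => F x (inner ℝ u (k x))) μ)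
    (hpos : μ {x | x ∈ S ∧ 0 < inner ℝ u (k x)} ≠ 0) (p q : ℝ) (hp : 0 ≤ p) (hq : 0 ≤ q)
    (hpq : p ≠ q) :
    (1 / 2) * rayJ μ k F u (√p) + (1 / 2) * rayJ μ k F u (√q)
      < rayJ μ k F u (√((1 / 2) * p + (1 / 2) * q)) := by
  have hr : 0 ≤ (1 / 2) * p + (1 / 2) * q := by positivity
  simp only [rayJ, Real.sq_sqrt hp, Real.sq_sqrt hq, Real.sq_sqrt hr]
  have i1 := hy.int_scale u hu _ (Real.sqrt_nonneg p)
  have i2 := hy.int_scale u hu _ (Real.sqrt_nonneg q)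
  have i3 := hy.int_scale u hu _ (Real.sqrt_nonneg ((1 / 2) * p + (1 / 2) * q))
  set G : X → ℝ := fun x => F x (√((1 / 2) * p + (1 / 2) * q) * inner ℝ u (k x)) -
    ((1 / 2) * F x (√p * inner ℝ u (k x)) + (1 / 2) * F x (√q * inner ℝ u (k x))) with hG
  have hGi : Integrable G μ := i3.sub ((i1.const_mul _).add (i2.const_mul _))
  have hG0 : 0 ≤ G := fun x => sub_nonneg.2
    (hy.conc_ineq x _ p q (1 / 2) (1 / 2) hp hq (by norm_num) (by norm_num) (by norm_num))
  have hGp : 0 < ∫ x, G x ∂μ := by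
    rw [integral_pos_iff_support_of_nonneg hG0 hGi]
    refine lt_of_lt_of_le (pos_iff_ne_zero.2 hpos) (measure_mono ?_)
    rintro x ⟨hx, hxp⟩
    have h1 := (hy.hstrict x hx _ hxp).2 (mem_Ici.2 hp) (mem_Ici.2 hq) hpq
      (by norm_num : (0:ℝ) < 1 / 2) (by norm_num : (0:ℝ) < 1 / 2) (by norm_num)
    simp only [smul_eq_mul] at h1
    simp only [Function.mem_support, hG]
    exact (sub_pos.2 h1).ne'
  have e : ∫ x, G x ∂μ = ∫ x, F x (√((1 / 2) * p + (1 / 2) * q) * inner ℝ u (k x)) ∂μ -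
      ((1 / 2) * ∫ x, F x (√p * inner ℝ u (k x)) ∂μ
        + (1 / 2) * ∫ x, F x (√q * inner ℝ u (k x)) ∂μ) := by
    have hs : Integrable (fun x => (1 / 2) * F x (√p * inner ℝ u (k x)) +
      (1 / 2) * F x (√q * inner ℝ u (k x))) μ := (i1.const_mul _).add (i2.const_mul _)
    simp only [hG]
    rw [integral_sub i3 hs,
      integral_add (i1.const_mul _) (i2.const_mul _), integral_const_mul, integral_const_mul]
  nlinarith

end VarHyp
end AbstractPart2

section AbstractPart3
open Set Filter Topology

namespace VarHyp

variable {H : Type*} [NormedAddCommGroup H] [InnerProductSpace ℝ H]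
    {X : Type*} [MeasurableSpace X] {μ : Measure X} {S : Set X} {k : X → H}
    {F F' : X → ℝ → ℝ} {D : X → ℝ} {B : ℝ}

lemma lip (hy : VarHyp μ S k F F' D B) (u ψ : H)
    (hψ : IntegrableOn (fun x => D x * |inner ℝ ψ (k x)|) Sᶜ μ) :
    ∃ G : X → ℝ, Integrable G μ ∧ ∀ t ∈ Icc (0:ℝ) 2, ∀ ε ∈ Icc (0:ℝ) 1, ∀ x,
      |F x (t * inner ℝ (u + ε • ψ) (k x)) - F x (t * inner ℝ u (k x))| ≤ ε * G x := by
  obtain ⟨C, hC⟩ := hy.hbd (2 * (B * ‖u‖ + B * ‖ψ‖))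
  have hB0 := hy.hB0
  refine ⟨fun x => S.indicator (fun _ => 2 * (|C| * (B * ‖ψ‖))) x +
    Sᶜ.indicator (fun x => 2 * (D x * |inner ℝ ψ (k x)|)) x, ?_, ?_⟩
  · refine Integrable.add ?_ ?_
    · rw [integrable_indicator_iff hy.hS]
      exact integrableOn_const hy.hSfin
    · rw [integrable_indicator_iff hy.hS.compl]
      exact hψ.const_mul 2
  · intro t ht ε hε x
    have hin : inner ℝ (u + ε • ψ) (k x) = inner ℝ u (k x) + ε * inner ℝ ψ (k x) := by
      simp [inner_add_left, inner_smul_left]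
    rw [hin]
    set v := inner ℝ u (k x)
    set p := inner ℝ ψ (k x) with hp
    have hdiff : |t * (v + ε * p) - t * v| ≤ 2 * (ε * |p|) := by
      rw [show t * (v + ε * p) - t * v = t * (ε * p) by ring, abs_mul, abs_mul,
        abs_of_nonneg ht.1, abs_of_nonneg hε.1]
      exact mul_le_mul_of_nonneg_right ht.2 (mul_nonneg hε.1 (abs_nonneg _))
    by_cases hx : x ∈ S
    · simp only [hx, indicator_of_mem, mem_compl_iff, not_true_eq_false, not_false_eq_true,
        indicator_of_notMem, add_zero]
      have hv := hy.v_bd u hx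
      have hpb := hy.v_bd ψ hx
      have hb1 : |t * v| ≤ 2 * (B * ‖u‖ + B * ‖ψ‖) := by
        rw [abs_mul, abs_of_nonneg ht.1]
        refine mul_le_mul ht.2 (hv.trans ?_) (abs_nonneg _) (by norm_num)
        have : 0 ≤ B * ‖ψ‖ := by positivity
        linarith
      have hb2 : |t * (v + ε * p)| ≤ 2 * (B * ‖u‖ + B * ‖ψ‖) := by
        rw [abs_mul, abs_of_nonneg ht.1]
        refine mul_le_mul ht.2 ((abs_add_le _ _).trans ?_) (abs_nonneg _) (by norm_num)
        refine add_le_add hv ?_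
        rw [abs_mul, abs_of_nonneg hε.1]
        exact (mul_le_of_le_one_left (abs_nonneg _) hε.2).trans hpb
      have := (convex_Icc (-(2 * (B * ‖u‖ + B * ‖ψ‖))) (2 * (B * ‖u‖ + B * ‖ψ‖))
        ).norm_image_sub_le_of_norm_hasDerivWithin_le (f := F x) (f' := F' x) (C := |C|)
        (fun s _ => (hy.hder x s).hasDerivWithinAt)
        (fun s hs => ((hC x hx s (abs_le.2 hs)).2).trans (le_abs_self C))
        (abs_le.1 hb1) (abs_le.1 hb2)
      simp only [Real.norm_eq_abs] at this
      refine this.trans ?_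
      calc |C| * |t * (v + ε * p) - t * v| ≤ |C| * (2 * (ε * (B * ‖ψ‖))) := by
            refine mul_le_mul_of_nonneg_left (hdiff.trans ?_) (abs_nonneg _)
            have := mul_le_mul_of_nonneg_left hpb hε.1
            linarith
        _ = _ := by ring
    · simp only [hx, indicator_of_mem, mem_compl_iff, not_false_eq_true,
        indicator_of_notMem, zero_add]
      have := convex_univ.norm_image_sub_le_of_norm_hasDerivWithin_le (f := F x) (f' := F' x)
        (C := D x) (x := t * v) (y := t * (v + ε * p))
        (fun s _ => (hy.hder x s).hasDerivWithinAt)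
        (fun s _ => hy.hD x hx s) (mem_univ _) (mem_univ _)
      simp only [Real.norm_eq_abs] at this
      refine this.trans ?_
      have hD0 : 0 ≤ D x := (abs_nonneg _).trans (hy.hD x hx 0)
      have := mul_le_mul_of_nonneg_left hdiff hD0
      linarith

lemma adm_add (hy : VarHyp μ S k F F' D B) (u ψ : H)
    (hu : Integrable (fun x => F x (inner ℝ u (k x))) μ)
    (hψ : IntegrableOn (fun x => D x * |inner ℝ ψ (k x)|) Sᶜ μ) (ε : ℝ) (hε : ε ∈ Icc (0:ℝ) 1) :
    Integrable (fun x => F x (inner ℝ (u + ε • ψ) (k x))) μ := by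
  obtain ⟨G, hG, hl⟩ := hy.lip u ψ hψ
  have h1 : Integrable (fun x => F x (inner ℝ (u + ε • ψ) (k x)) - F x (inner ℝ u (k x))) μ := by
    refine (hG.const_mul ε).mono' ((hy.measF (hy.hk _)).sub (hy.measF (hy.hk _))).aestronglyMeasurable
      (Eventually.of_forall fun x => ?_)
    simpa using hl 1 ⟨by norm_num, by norm_num⟩ ε hε x
  refine (h1.add hu).congr (Eventually.of_forall fun x => ?_)
  simp

lemma slope_lim (hy : VarHyp μ S k F F' D B) (x : X) (v p : ℝ) :
    Tendsto (fun q : ℝ × ℝ => (F x (q.1 * (v + q.2 * p)) - F x (q.1 * v)) / q.2)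
      (𝓝 1 ×ˢ 𝓝[>] 0) (𝓝 (F' x v * p)) := by
  have hs : HasStrictDerivAt (F x) (F' x v) v :=
    hasStrictDerivAt_of_hasDerivAt_of_continuousAt (Eventually.of_forall fun s => hy.hder x s)
      (hy.hcont x).continuousAt
  have hl : (𝓝 (1:ℝ) ×ˢ 𝓝[>] (0:ℝ)) ≤ 𝓝 ((1:ℝ), (0:ℝ)) := by
    rw [nhds_prod_eq]
    exact prod_mono le_rfl nhdsWithin_le_nhds
  have ht : Tendsto (fun q : ℝ × ℝ => (q.1 * (v + q.2 * p), q.1 * v)) (𝓝 1 ×ˢ 𝓝[>] 0)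
      (𝓝 (v, v)) := by
    have : Continuous (fun q : ℝ × ℝ => (q.1 * (v + q.2 * p), q.1 * v)) := by fun_prop
    have h2 := (this.tendsto ((1:ℝ), (0:ℝ))).mono_left hl
    simpa using h2
  have hne : ∀ᶠ q : ℝ × ℝ in 𝓝 1 ×ˢ 𝓝[>] 0, 0 < q.2 :=
    (eventually_mem_nhdsWithin (a := (0:ℝ)) (s := Ioi 0)).prod_inr _
  have ho := (hasStrictDerivAt_iff_hasStrictFDerivAt.1 hs).isLittleO.comp_tendsto ht
  have ho2 : (fun q : ℝ × ℝ => F x (q.1 * (v + q.2 * p)) - F x (q.1 * v)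
      - F' x v * (q.1 * (q.2 * p))) =o[𝓝 1 ×ˢ 𝓝[>] 0] (fun q : ℝ × ℝ => q.2) := by
    have hO : (fun q : ℝ × ℝ => q.1 * (v + q.2 * p) - q.1 * v) =O[𝓝 1 ×ˢ 𝓝[>] 0]
        (fun q : ℝ × ℝ => q.2) := by
      have hb : (fun q : ℝ × ℝ => q.1 * p) =O[𝓝 1 ×ˢ 𝓝[>] 0] (fun _ => (1:ℝ)) := by
        have : Continuous (fun q : ℝ × ℝ => q.1 * p) := by fun_prop
        exact ((this.tendsto ((1:ℝ), (0:ℝ))).mono_left hl).isBigO_one ℝ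
      have := hb.mul (Asymptotics.isBigO_refl (fun q : ℝ × ℝ => q.2) (𝓝 1 ×ˢ 𝓝[>] 0))
      simp only [one_mul] at this
      refine this.congr_left fun q => ?_
      ring
    refine (ho.trans_isBigO hO).congr_left fun q => ?_
    simp
    ring
  have h3 := ho2.tendsto_div_nhds_zero
  have h4 : Tendsto (fun q : ℝ × ℝ => F' x v * (q.1 * p)) (𝓝 1 ×ˢ 𝓝[>] 0) (𝓝 (F' x v * p)) := by
    have : Continuous (fun q : ℝ × ℝ => F' x v * (q.1 * p)) := by fun_prop
    simpa using (this.tendsto ((1:ℝ), (0:ℝ))).mono_left hl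
  have h5 := h3.add h4
  rw [zero_add] at h5
  refine h5.congr' ?_
  filter_upwards [hne] with q hq
  field_simp
  ring

lemma EL_ge (hy : VarHyp μ S k F F' D B) (u : H) (c : ℝ)
    (hu : Integrable (fun x => F x (inner ℝ u (k x))) μ)
    (hpos : μ {x | x ∈ S ∧ 0 < inner ℝ u (k x)} ≠ 0)
    (hJ1 : rayJ μ k F u 1 = c) (hJ : ∀ t, 0 ≤ t → rayJ μ k F u t ≤ c)
    (hmin : ∀ u' : H, u' ≠ 0 → Integrable (fun x => F x (inner ℝ u' (k x))) μ →
        ∀ m, (∀ t, 0 ≤ t → rayJ μ k F u' t ≤ m) → c ≤ m)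
    (ψ : H) (hψ : IntegrableOn (fun x => D x * |inner ℝ ψ (k x)|) Sᶜ μ) :
    0 ≤ inner ℝ u ψ + ∫ x, F' x (inner ℝ u (k x)) * inner ℝ ψ (k x) ∂μ := by
  obtain ⟨G, hG, hl⟩ := hy.lip u ψ hψ
  have hin : ∀ ε x, inner ℝ (u + ε • ψ) (k x) = inner ℝ u (k x) + ε * inner ℝ ψ (k x) := by
    intro ε x
    simp [inner_add_left, inner_smul_left]
  -- difference of functionals
  have hdiff : ∀ t ∈ Icc (0:ℝ) 2, ∀ ε ∈ Icc (0:ℝ) 1,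
      rayJ μ k F (u + ε • ψ) t - rayJ μ k F u t =
        t ^ 2 * (ε * inner ℝ u ψ + ε ^ 2 * ‖ψ‖ ^ 2 / 2) +
        ∫ x, (F x (t * inner ℝ (u + ε • ψ) (k x)) - F x (t * inner ℝ u (k x))) ∂μ := by
    intro t ht ε hε
    rw [integral_sub (hy.int_scale _ (hy.adm_add u ψ hu hψ ε hε) t ht.1)
      (hy.int_scale _ hu t ht.1), rayJ, rayJ, norm_add_sq_real, norm_smul, inner_smul_right,
      mul_pow, Real.norm_eq_abs, sq_abs]
    ring
  set L := inner ℝ u ψ + ∫ x, F' x (inner ℝ u (k x)) * inner ℝ ψ (k x) ∂μ with hL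
  by_contra hneg
  push Not at hneg
  have hl1 : (𝓝 (1:ℝ) ×ˢ 𝓝[>] (0:ℝ)) ≤ 𝓝 ((1:ℝ), (0:ℝ)) := by
    rw [nhds_prod_eq]
    exact prod_mono le_rfl nhdsWithin_le_nhds
  have hev : ∀ᶠ q : ℝ × ℝ in 𝓝 1 ×ˢ 𝓝[>] 0, q.1 ∈ Icc (0:ℝ) 2 ∧ q.2 ∈ Ioc (0:ℝ) 1 := by
    refine Eventually.prod_mk ?_ ?_
    · exact Icc_mem_nhds (by norm_num) (by norm_num)
    · exact Ioc_mem_nhdsGT (by norm_num)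
  have hQ : Tendsto (fun q : ℝ × ℝ => (rayJ μ k F (u + q.2 • ψ) q.1 - rayJ μ k F u q.1) / q.2)
      (𝓝 1 ×ˢ 𝓝[>] 0) (𝓝 L) := by
    have h1 : Tendsto (fun q : ℝ × ℝ => q.1 ^ 2 * (inner ℝ u ψ + q.2 * ‖ψ‖ ^ 2 / 2))
        (𝓝 1 ×ˢ 𝓝[>] 0) (𝓝 (inner ℝ u ψ)) := by
      have : Continuous (fun q : ℝ × ℝ => q.1 ^ 2 * (inner ℝ u ψ + q.2 * ‖ψ‖ ^ 2 / 2)) := by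
        fun_prop
      simpa using (this.tendsto ((1:ℝ), (0:ℝ))).mono_left hl1
    have h2 : Tendsto (fun q : ℝ × ℝ => ∫ x, (F x (q.1 * inner ℝ (u + q.2 • ψ) (k x)) -
        F x (q.1 * inner ℝ u (k x))) / q.2 ∂μ) (𝓝 1 ×ˢ 𝓝[>] 0)
        (𝓝 (∫ x, F' x (inner ℝ u (k x)) * inner ℝ ψ (k x) ∂μ)) := by
      refine tendsto_integral_filter_of_dominated_convergence G ?_ ?_ hG ?_
      · refine Eventually.of_forall fun q => ?_
        exact (((hy.measF ((hy.hk _).const_mul _)).sub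
          (hy.measF ((hy.hk _).const_mul _))).div_const _).aestronglyMeasurable
      · filter_upwards [hev] with q hq
        refine Eventually.of_forall fun x => ?_
        rw [norm_div, Real.norm_eq_abs, Real.norm_eq_abs, abs_of_pos hq.2.1, div_le_iff₀ hq.2.1,
          mul_comm (G x)]
        exact hl q.1 hq.1 q.2 ⟨hq.2.1.le, hq.2.2⟩ x
      · refine Eventually.of_forall fun x => ?_
        simp only [hin]
        exact hy.slope_lim x _ _
    refine (h1.add h2).congr' ?_
    filter_upwards [hev] with q hq
    have hq0 := hq.2.1
    rw [hdiff q.1 hq.1 q.2 ⟨hq.2.1.le, hq.2.2⟩, integral_div]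
    field_simp
  have hQ2 : ∀ᶠ q : ℝ × ℝ in 𝓝 1 ×ˢ 𝓝[>] 0,
      rayJ μ k F (u + q.2 • ψ) q.1 ≤ c + q.2 * (L / 2) := by
    filter_upwards [hev, hQ.eventually_lt_const (by linarith : L < L / 2)] with q hq hq2
    rw [div_lt_iff₀ hq.2.1] at hq2
    have := hJ q.1 hq.1.1
    linarith
  obtain ⟨pa, hpa, pb, hpb, hab⟩ := eventually_prod_iff.1 hQ2
  obtain ⟨δ₀, hδ₀, hball⟩ := Metric.eventually_nhds_iff.1 hpa
  set δ := min (δ₀ / 2) (1 / 2) with hδdef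
  have hδ : 0 < δ := by positivity
  have hδ1 : δ ≤ 1 / 2 := min_le_right _ _
  have hδ2 : δ < δ₀ := lt_of_le_of_lt (min_le_left _ _) (by linarith)
  -- convergence for fixed t
  have hconv : ∀ t ∈ Icc (0:ℝ) 2, Tendsto (fun ε : ℝ => rayJ μ k F (u + ε • ψ) t) (𝓝[>] (0:ℝ))
      (𝓝 (rayJ μ k F u t)) := by
    intro t ht
    have hz : Tendsto (fun ε : ℝ => t ^ 2 * (ε * |inner ℝ u ψ| + ε ^ 2 * ‖ψ‖ ^ 2 / 2)
        + ε * ∫ x, G x ∂μ) (𝓝[>] 0) (𝓝 0) := by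
      have : Continuous (fun ε : ℝ => t ^ 2 * (ε * |inner ℝ u ψ| + ε ^ 2 * ‖ψ‖ ^ 2 / 2)
        + ε * ∫ x, G x ∂μ) := by fun_prop
      simpa using (this.tendsto 0).mono_left (nhdsWithin_le_nhds (s := Ioi 0))
    rw [tendsto_iff_norm_sub_tendsto_zero]
    refine squeeze_zero' (Eventually.of_forall fun _ => norm_nonneg _) ?_ hz
    filter_upwards [Ioc_mem_nhdsGT (by norm_num : (0:ℝ) < 1)] with ε hε
    have hε' : ε ∈ Icc (0:ℝ) 1 := ⟨hε.1.le, hε.2⟩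
    rw [hdiff t ht ε hε']
    refine (norm_add_le _ _).trans (add_le_add ?_ ?_)
    · rw [norm_mul, Real.norm_eq_abs, Real.norm_eq_abs, abs_of_nonneg (sq_nonneg t)]
      refine mul_le_mul_of_nonneg_left ((abs_add_le _ _).trans ?_) (sq_nonneg t)
      rw [abs_mul, abs_of_pos hε.1, abs_of_nonneg (by positivity : 0 ≤ ε ^ 2 * ‖ψ‖ ^ 2 / 2)]
    · rw [← integral_const_mul]
      refine norm_integral_le_of_norm_le (hG.const_mul ε) (Eventually.of_forall fun x => ?_)
      exact hl t ht ε hε' x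
  have hs1 : (√1 : ℝ) = 1 := Real.sqrt_one
  have hstr : ∀ τ, 0 ≤ τ → τ ≠ 1 → rayJ μ k F u (√τ) < rayJ μ k F u 1 := by
    intro τ hτ hτ1
    have h1 := hy.ray_strict u hu hpos τ 1 hτ zero_le_one hτ1
    have h2 := hJ (√((1 / 2) * τ + (1 / 2) * 1)) (Real.sqrt_nonneg _)
    rw [hs1] at h1
    linarith
  have hmem : ∀ τ, 0 ≤ τ → τ ≤ 2 → √τ ∈ Icc (0:ℝ) 2 := by
    intro τ h0 h2
    refine ⟨Real.sqrt_nonneg _, ?_⟩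
    rw [Real.sqrt_le_left (by norm_num)]
    linarith
  have e1 : ∀ᶠ ε in 𝓝[>] (0:ℝ), rayJ μ k F (u + ε • ψ) (√(1 - δ)) < rayJ μ k F (u + ε • ψ) 1 :=
    (hconv _ (hmem (1 - δ) (by linarith) (by linarith))).eventually_lt
      (hconv 1 ⟨by norm_num, by norm_num⟩) (hstr (1 - δ) (by linarith) (ne_of_lt (by linarith)))
  have e2 : ∀ᶠ ε in 𝓝[>] (0:ℝ), rayJ μ k F (u + ε • ψ) (√(1 + δ)) < rayJ μ k F (u + ε • ψ) 1 :=
    (hconv _ (hmem (1 + δ) (by linarith) (by linarith))).eventually_lt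
      (hconv 1 ⟨by norm_num, by norm_num⟩) (hstr (1 + δ) (by linarith) (ne_of_gt (by linarith)))
  obtain ⟨ε, hε1, hε2, hεb, hε⟩ :=
    (e1.and (e2.and (hpb.and (Ioc_mem_nhdsGT (by norm_num : (0:ℝ) < 1))))).exists
  have hadm := hy.adm_add u ψ hu hψ ε ⟨hε.1.le, hε.2⟩
  set u' := u + ε • ψ with hu'
  have hu'0 : u' ≠ 0 := by
    intro h0
    rw [h0] at hε1
    simp [rayJ, hy.hF0] at hε1
  have hone : rayJ μ k F u' 1 ≤ c + ε * (L / 2) := hab (x := 1) (hball (by simpa using hδ₀)) hεb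
  have hall : ∀ t, 0 ≤ t → rayJ μ k F u' t ≤ c + ε * (L / 2) := by
    intro t ht
    have hconc := fun p a b hp ha hb hab => hy.ray_concave u' hadm p 1 a b hp zero_le_one ha hb hab
    simp only [hs1] at hconc
    rcases lt_or_ge (t ^ 2) (1 - δ) with h1 | h1
    · refine le_trans ?_ hone
      by_contra hcon
      push Not at hcon
      have hd : 0 < 1 - t ^ 2 := by linarith
      have := hconc (t ^ 2) (δ / (1 - t ^ 2)) ((1 - t ^ 2 - δ) / (1 - t ^ 2)) (by positivity)
        (by positivity) (div_nonneg (by linarith) hd.le) (by field_simp; ring)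
      rw [show δ / (1 - t ^ 2) * t ^ 2 + (1 - t ^ 2 - δ) / (1 - t ^ 2) * 1 = 1 - δ by
        field_simp; ring, Real.sqrt_sq ht] at this
      have h3 : δ / (1 - t ^ 2) * rayJ μ k F u' 1 < δ / (1 - t ^ 2) * rayJ μ k F u' t :=
        mul_lt_mul_of_pos_left hcon (by positivity)
      have h4 : δ / (1 - t ^ 2) * rayJ μ k F u' 1 +
        (1 - t ^ 2 - δ) / (1 - t ^ 2) * rayJ μ k F u' 1 = rayJ μ k F u' 1 := by field_simp; ring
      linarith
    · rcases lt_or_ge (1 + δ) (t ^ 2) with h2 | h2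
      · refine le_trans ?_ hone
        by_contra hcon
        push Not at hcon
        have hd : 0 < t ^ 2 - 1 := by linarith
        have := hconc (t ^ 2) (δ / (t ^ 2 - 1)) ((t ^ 2 - 1 - δ) / (t ^ 2 - 1)) (by positivity)
          (by positivity) (div_nonneg (by linarith) hd.le) (by field_simp; ring)
        rw [show δ / (t ^ 2 - 1) * t ^ 2 + (t ^ 2 - 1 - δ) / (t ^ 2 - 1) * 1 = 1 + δ by
          field_simp; ring, Real.sqrt_sq ht] at this
        have h3 : δ / (t ^ 2 - 1) * rayJ μ k F u' 1 < δ / (t ^ 2 - 1) * rayJ μ k F u' t :=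
          mul_lt_mul_of_pos_left hcon (by positivity)
        have h4 : δ / (t ^ 2 - 1) * rayJ μ k F u' 1 +
          (t ^ 2 - 1 - δ) / (t ^ 2 - 1) * rayJ μ k F u' 1 = rayJ μ k F u' 1 := by field_simp; ring
        linarith
      · refine hab (x := t) (hball ?_) hεb
        rw [Real.dist_eq]
        refine lt_of_le_of_lt ?_ hδ2
        rw [abs_le]
        constructor <;> nlinarith
  have := hmin u' hu'0 hadm _ hall
  nlinarith [hε.1]

/-- Abstract existence theorem. -/
theorem exists_crit [CompleteSpace H] [TopologicalSpace.SeparableSpace H]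
    (hy : VarHyp μ S k F F' D B) (u₀ : H)
    (hu₀ : Integrable (fun x => F x (inner ℝ u₀ (k x))) μ)
    (hpos : μ {x | x ∈ S ∧ 0 < inner ℝ u₀ (k x)} ≠ 0) :
    ∃ u : H, Integrable (fun x => F x (inner ℝ u (k x))) μ ∧
      (∃ x ∈ S, 0 < inner ℝ u (k x)) ∧
      ∀ ψ : H, IntegrableOn (fun x => D x * |inner ℝ ψ (k x)|) Sᶜ μ →
        inner ℝ u ψ + ∫ x, F' x (inner ℝ u (k x)) * inner ℝ ψ (k x) ∂μ = 0 := by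
  obtain ⟨u, c, -, hu, hp, hJ1, hJ, hmin⟩ := hy.exists_min u₀ hu₀ hpos
  refine ⟨u, hu, ?_, ?_⟩
  · obtain ⟨x, hx⟩ := nonempty_of_measure_ne_zero hp
    exact ⟨x, hx⟩
  · intro ψ hψ
    have h1 := hy.EL_ge u c hu hp hJ1 hJ hmin ψ hψ
    have h2 := hy.EL_ge u c hu hp hJ1 hJ hmin (-ψ) (by simpa using hψ)
    simp only [inner_neg_right, inner_neg_left, mul_neg, integral_neg] at h2
    linarith

end VarHyp
end AbstractPart3

section ScalarPart
open Set Filter Topology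

lemma h_eq (y : ℝ) : h y = (1/2) * y * √(1 + y^2) + (1/2) * Real.arsinh y := rfl

lemma sq1_pos (y : ℝ) : 0 < √(1 + y^2) := Real.sqrt_pos.2 (by positivity)
lemma sq1_sq (y : ℝ) : √(1 + y^2) ^ 2 = 1 + y^2 := Real.sq_sqrt (by positivity)
lemma sq1_ge (y : ℝ) : 1 ≤ √(1 + y^2) := by
  rw [Real.one_le_sqrt]; nlinarith [sq_nonneg y]

lemma sq1_hasDerivAt (y : ℝ) : HasDerivAt (fun y : ℝ => √(1 + y^2)) (y / √(1 + y^2)) y := by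
  have h1 : HasDerivAt (fun y : ℝ => 1 + y^2) (2 * y) y := by
    simpa using (hasDerivAt_pow 2 y).const_add 1
  convert h1.sqrt (by positivity) using 1
  field_simp

lemma h_hasDerivAt (y : ℝ) : HasDerivAt h (√(1 + y^2)) y := by
  have h2 := (((hasDerivAt_id y).const_mul (1/2 : ℝ)).mul (sq1_hasDerivAt y)).add
    ((Real.hasDerivAt_arsinh y).const_mul (1/2 : ℝ))
  refine (h2.congr_deriv ?_).congr_of_eventuallyEq (Eventually.of_forall fun z => ?_)
  · have := sq1_pos y
    have h3 := sq1_sq y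
    simp only [id]
    field_simp
    nlinarith
  · simp [h_eq]

lemma h_cont : Continuous h := continuous_iff_continuousAt.2 fun y => (h_hasDerivAt y).continuousAt

lemma h_strictMono : StrictMono h := by
  apply strictMono_of_deriv_pos
  intro y
  rw [(h_hasDerivAt y).deriv]
  exact sq1_pos y

lemma h_zero : h 0 = 0 := by simp [h_eq]

lemma h_neg (y : ℝ) : h (-y) = - h y := by
  simp [h_eq, Real.arsinh_neg]; ring

/-- comparison of functions on the half line through derivatives -/
lemma le_of_deriv_le {a b a' b' : ℝ → ℝ} (ha : ∀ y, HasDerivAt a (a' y) y)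
    (hb : ∀ y, HasDerivAt b (b' y) y) (h0 : a 0 ≤ b 0) (hle : ∀ y, 0 ≤ y → a' y ≤ b' y) :
    ∀ y, 0 ≤ y → a y ≤ b y := by
  have : MonotoneOn (fun y => b y - a y) (Ici 0) := by
    apply monotoneOn_of_deriv_nonneg (convex_Ici 0)
    · exact fun y _ => ((hb y).sub (ha y)).continuousAt.continuousWithinAt
    · exact fun y _ => ((hb y).sub (ha y)).differentiableAt.differentiableWithinAt
    · intro y hy
      rw [interior_Ici, mem_Ioi] at hy
      have := ((hb y).sub (ha y)).deriv
      simp only [Pi.sub_def] at this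
      rw [this]
      linarith [hle y hy.le]
  intro y hy
  have h1 := this (mem_Ici.2 le_rfl) (mem_Ici.2 hy) hy
  simp only at h1
  linarith

lemma h_ge_self (y : ℝ) (hy : 0 ≤ y) : y ≤ h y :=
  le_of_deriv_le (a := fun y => y) (b := h) (fun y => hasDerivAt_id y) h_hasDerivAt
    (by simp [h_zero]) (fun y _ => sq1_ge y) y hy

lemma h_le (y : ℝ) (hy : 0 ≤ y) : h y ≤ y * √(1 + y^2) := by
  refine le_of_deriv_le (a := h) (b := fun y => y * √(1 + y^2)) h_hasDerivAt
    (fun y => (hasDerivAt_id y).mul (sq1_hasDerivAt y)) (by simp [h_zero]) (fun y hy => ?_) y hy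
  have := sq1_pos y
  simp only [id]
  have : 0 ≤ y * (y / √(1 + y^2)) := by positivity
  linarith

lemma h_pos (y : ℝ) (hy : 0 < y) : 0 < h y := lt_of_lt_of_le hy (h_ge_self y hy.le)

lemma arsinh_ge (y : ℝ) (hy : 0 ≤ y) : y / √(1 + y^2) ≤ Real.arsinh y := by
  refine le_of_deriv_le (a := fun y => y / √(1 + y^2)) (b := Real.arsinh)
    (fun y => (hasDerivAt_id y).div (sq1_hasDerivAt y) (sq1_pos y).ne') Real.hasDerivAt_arsinh
    (by simp) (fun y hy => ?_) y hy
  have h1 := sq1_pos y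
  have h3 := sq1_sq y
  have h4 := sq1_ge y
  simp only [id]
  rw [div_le_iff₀ (by positivity)]
  field_simp
  nlinarith

lemma h_ge2 (y : ℝ) (hy : 0 ≤ y) : y * (2 + y^2) / (2 * √(1 + y^2)) ≤ h y := by
  have h1 := arsinh_ge y hy
  have h2 := sq1_pos y
  have h3 := sq1_sq y
  rw [h_eq]
  have : y * (2 + y^2) / (2 * √(1 + y^2)) = (1/2) * y * √(1 + y^2) + (1/2) * (y / √(1 + y^2)) := by
    field_simp
    rw [h3]; ring
  linarith

/-- the auxiliary quotient -/
noncomputable def Aq (y : ℝ) : ℝ := y / (√(1 + y^2) * h y)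

lemma Aq_pos (y : ℝ) (hy : 0 < y) : 0 < Aq y :=
  div_pos hy (mul_pos (sq1_pos y) (h_pos y hy))

lemma alg1 (y σ H : ℝ) (hσ : 0 < σ) (e : σ ^ 2 = 1 + y ^ 2) :
    (y / σ * H + σ * σ) * σ = y * H + σ * (1 + y ^ 2) := by
  rw [← e]; field_simp

lemma alg2 (y σ H : ℝ) (e : σ ^ 2 = 1 + y ^ 2) : σ * H * σ = (1 + y ^ 2) * H := by
  rw [← e]; ring

lemma Aq_anti : AntitoneOn Aq (Ioi 0) := by
  apply antitoneOn_of_deriv_nonpos (convex_Ioi 0)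
  · intro y hy
    have := h_pos y hy
    exact (((hasDerivAt_id y).div ((sq1_hasDerivAt y).mul (h_hasDerivAt y))
      (mul_pos (sq1_pos y) this).ne').continuousAt).continuousWithinAt
  · intro y hy
    rw [interior_Ioi] at hy
    have := h_pos y hy
    exact (((hasDerivAt_id y).div ((sq1_hasDerivAt y).mul (h_hasDerivAt y))
      (mul_pos (sq1_pos y) this).ne').differentiableAt).differentiableWithinAt
  · intro y hy
    rw [interior_Ioi, mem_Ioi] at hy
    have h0 := h_pos y hy
    have hs := sq1_pos y
    have := ((hasDerivAt_id y).div ((sq1_hasDerivAt y).mul (h_hasDerivAt y))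
      (mul_pos hs h0).ne').deriv
    have e : (id / ((fun y : ℝ => √(1 + y^2)) * h)) = Aq := by ext z; simp [Aq]
    rw [e] at this
    rw [this]
    apply div_nonpos_of_nonpos_of_nonneg _ (by positivity)
    simp only [Pi.mul_apply, id]
    have h1 := sq1_sq y
    have h2 := h_le y hy.le
    have h3 := sq1_ge y
    rw [sub_nonpos]
    have : y * (y / √(1 + y ^ 2) * h y + √(1 + y ^ 2) * √(1 + y ^ 2)) * √(1 + y^2)
        = y^2 * h y + y * √(1+y^2) * (1 + y^2) := by
      rw [mul_assoc, alg1 _ _ _ hs h1]; ring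
    rw [← mul_le_mul_iff_left₀ hs, this]
    have : 1 * (√(1 + y ^ 2) * h y)  * √(1 + y ^ 2) = (1 + y^2) * h y := by
      rw [one_mul, alg2 _ _ _ h1]
    rw [this]
    have : h y ≤ y * √(1+y^2) * (1 + y^2) := by
      refine h2.trans ?_
      have : 0 ≤ y * √(1+y^2) := by positivity
      nlinarith [mul_nonneg this (sq_nonneg y)]
    linarith

lemma Bq_mono : MonotoneOn (fun y => y^2 * Aq y) (Ioi 0) := by
  have hd : ∀ y, 0 < y → HasDerivAt (fun y => y^3 / (√(1 + y^2) * h y)) _ y := fun y hy =>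
    ((hasDerivAt_pow 3 y).div ((sq1_hasDerivAt y).mul (h_hasDerivAt y))
      (mul_pos (sq1_pos y) (h_pos y hy)).ne')
  have e : (fun y => y^2 * Aq y) = (fun y => y^3 / (√(1 + y^2) * h y)) := by
    ext y; simp only [Aq]; ring
  rw [e]
  apply monotoneOn_of_deriv_nonneg (convex_Ioi 0)
  · intro y hy
    exact (hd y hy).continuousAt.continuousWithinAt
  · intro y hy
    rw [interior_Ioi] at hy
    exact (hd y hy).differentiableAt.differentiableWithinAt
  · intro y hy
    rw [interior_Ioi, mem_Ioi] at hy
    have h0 := h_pos y hy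
    have hs := sq1_pos y
    rw [(hd y hy).deriv]
    apply div_nonneg _ (by positivity)
    try simp only [Pi.mul_apply]
    have h1 := sq1_sq y
    have h2 := h_ge2 y hy.le
    rw [div_le_iff₀ (by positivity)] at h2
    rw [sub_nonneg]
    rw [← mul_le_mul_iff_left₀ hs]
    have a1 : y ^ 3 * (y / √(1 + y ^ 2) * h y + √(1 + y ^ 2) * √(1 + y ^ 2)) * √(1 + y^2)
        = y^2 * (y^2 * h y + y * √(1+y^2) * (1 + y^2)) := by
      rw [mul_assoc, alg1 _ _ _ hs h1]; ring
    have a2 : ((3:ℕ):ℝ) * y ^ (3 - 1) * (√(1 + y ^ 2) * h y)  * √(1 + y ^ 2)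
        = y^2 * (3 * (1 + y^2) * h y) := by
      rw [mul_assoc, alg2 _ _ _ h1]; norm_num; ring
    rw [a1, a2]
    apply mul_le_mul_of_nonneg_left _ (by positivity)
    have : y * √(1+y^2) * (1 + y^2) ≤ (3 + 2 * y^2) * h y := by
      rw [← mul_le_mul_iff_left₀ hs]
      have : y * √(1+y^2) * (1 + y^2) * √(1+y^2) = y * (1+y^2)^2 := by
        calc _ = y * (√(1+y^2)^2) * (1 + y^2) := by ring
          _ = _ := by rw [h1]; ring
      rw [this]
      have : (3 + 2*y^2) * (y * (2 + y^2)) ≤ (3 + 2*y^2) * (h y * (2 * √(1 + y^2))) :=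
        mul_le_mul_of_nonneg_left h2 (by positivity)
      have h5 : 0 ≤ y * y^2 := by positivity
      nlinarith
    nlinarith

lemma Cq_strict (p : ℝ) (hp : 2 < p) : StrictMonoOn (fun y => y^p * Aq y) (Ioi 0) := by
  intro x hx y hy hxy
  have hx' : (0:ℝ) < x := hx
  have hy' : (0:ℝ) < y := hy
  have e : ∀ z : ℝ, 0 < z → z^p * Aq z = z^(p-2) * (z^2 * Aq z) := by
    intro z hz
    rw [← mul_assoc, ← Real.rpow_natCast z 2, ← Real.rpow_add hz]; norm_num
  simp only
  rw [e x hx', e y hy']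
  have h1 : x^(p-2) < y^(p-2) := Real.rpow_lt_rpow hx'.le hxy (by linarith)
  have h2 := Bq_mono hx hy hxy.le
  simp only at h2
  have h3 : 0 < x^2 * Aq x := mul_pos (by positivity) (Aq_pos x hx')
  have h4 : 0 < x^(p-2) := Real.rpow_pos_of_pos hx' _
  nlinarith


end ScalarPart

section ScalarPart2
open Set Filter Topology

lemma f_strictMono {f : ℝ → ℝ} (hf₂ : Function.RightInverse f h) : StrictMono f := by
  intro a b hab
  rw [← h_strictMono.lt_iff_lt, hf₂ a, hf₂ b]
  exact hab

lemma f_cont {f : ℝ → ℝ} (hf₁ : Function.LeftInverse f h) (hf₂ : Function.RightInverse f h) :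
    Continuous f :=
  (f_strictMono hf₂).monotone.continuous_of_surjective hf₁.surjective

lemma f_zero {f : ℝ → ℝ} (hf₁ : Function.LeftInverse f h) : f 0 = 0 := by
  have := hf₁ 0
  rwa [h_zero] at this

lemma f_hasDerivAt {f : ℝ → ℝ} (hf₁ : Function.LeftInverse f h) (hf₂ : Function.RightInverse f h)
    (s : ℝ) : HasDerivAt f (1 / √(1 + f s ^ 2)) s := by
  rw [one_div]
  exact HasDerivAt.of_local_left_inverse (f_cont hf₁ hf₂).continuousAt (h_hasDerivAt (f s))
    (sq1_pos _).ne' (Eventually.of_forall hf₂)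

lemma f_pos {f : ℝ → ℝ} (hf₁ : Function.LeftInverse f h) (hf₂ : Function.RightInverse f h)
    {s : ℝ} (hs : 0 < s) : 0 < f s := by
  rw [← f_zero hf₁]; exact f_strictMono hf₂ hs

lemma f_nonpos {f : ℝ → ℝ} (hf₁ : Function.LeftInverse f h) (hf₂ : Function.RightInverse f h)
    {s : ℝ} (hs : s ≤ 0) : f s ≤ 0 := by
  rw [← f_zero hf₁]; exact (f_strictMono hf₂).monotone hs

lemma f_neg {f : ℝ → ℝ} (hf₁ : Function.LeftInverse f h) (hf₂ : Function.RightInverse f h)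
    (s : ℝ) : f (-s) = - f s := by
  apply h_strictMono.injective
  rw [hf₂, h_neg, hf₂]

lemma f_abs_le {f : ℝ → ℝ} (hf₁ : Function.LeftInverse f h) (hf₂ : Function.RightInverse f h)
    (s : ℝ) : |f s| ≤ |s| := by
  have key : ∀ s, 0 ≤ s → |f s| ≤ |s| := by
    intro s hs
    have h1 : 0 ≤ f s := by rw [← f_zero hf₁]; exact (f_strictMono hf₂).monotone hs
    have := h_ge_self _ h1
    rw [hf₂] at this
    rwa [abs_of_nonneg h1, abs_of_nonneg hs]
  rcases le_total 0 s with hs | hs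
  · exact key s hs
  · have := key (-s) (by linarith)
    rwa [f_neg hf₁ hf₂, abs_neg, abs_neg] at this

lemma abs_mul_inv_sq1 (y : ℝ) : |y| * (1 / √(1 + y ^ 2)) ≤ 1 := by
  rw [mul_one_div, div_le_one (sq1_pos y)]
  apply Real.abs_le_sqrt
  linarith

lemma inv_sq1_le (y : ℝ) : 1 / √(1 + y ^ 2) ≤ 1 := by
  rw [div_le_one (sq1_pos y)]; exact sq1_ge y

/-- General concavity along rays. -/
lemma ray_hasDerivAt {P P' : ℝ → ℝ} (hder : ∀ s, HasDerivAt P (P' s) s) (s τ : ℝ) (hs : 0 < s)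
    (hτ : 0 < τ) : HasDerivAt (fun τ => P (√τ * s)) (s ^ 2 / 2 * (P' (√τ * s) / (√τ * s))) τ := by
  have h1 : HasDerivAt (fun τ : ℝ => √τ * s) (1 / (2 * √τ) * s) τ :=
    (Real.hasDerivAt_sqrt hτ.ne').mul_const s
  refine ((hder (√τ * s)).comp τ h1).congr_deriv ?_
  have := Real.sqrt_pos.2 hτ
  field_simp

lemma conc_of_ratio {P P' : ℝ → ℝ} (hder : ∀ s, HasDerivAt P (P' s) s)
    (ha : AntitoneOn (fun σ => P' σ / σ) (Ioi 0)) (s : ℝ) (hs : 0 < s) :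
    ConcaveOn ℝ (Ici (0:ℝ)) (fun τ => P (√τ * s)) := by
  have hP : Continuous P := continuous_iff_continuousAt.2 fun s => (hder s).continuousAt
  apply AntitoneOn.concaveOn_of_deriv (convex_Ici 0)
  · exact (hP.comp (Real.continuous_sqrt.mul continuous_const)).continuousOn
  · intro τ hτ
    rw [interior_Ici] at hτ
    exact (ray_hasDerivAt hder s τ hs hτ).differentiableAt.differentiableWithinAt
  · rw [interior_Ici]
    intro a ha' b hb' hab
    have ha0 : (0:ℝ) < a := ha'
    have hb0 : (0:ℝ) < b := hb'
    rw [(ray_hasDerivAt hder s a hs ha0).deriv, (ray_hasDerivAt hder s b hs hb0).deriv]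
    apply mul_le_mul_of_nonneg_left _ (by positivity)
    exact ha (mul_pos (Real.sqrt_pos.2 ha0) hs) (mul_pos (Real.sqrt_pos.2 hb0) hs)
      (mul_le_mul_of_nonneg_right (Real.sqrt_le_sqrt hab) hs.le)

lemma strict_conc_of_ratio {P P' : ℝ → ℝ} (hder : ∀ s, HasDerivAt P (P' s) s)
    (ha : StrictAntiOn (fun σ => P' σ / σ) (Ioi 0)) (s : ℝ) (hs : 0 < s) :
    StrictConcaveOn ℝ (Ici (0:ℝ)) (fun τ => P (√τ * s)) := by
  have hP : Continuous P := continuous_iff_continuousAt.2 fun s => (hder s).continuousAt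
  apply StrictAntiOn.strictConcaveOn_of_deriv (convex_Ici 0)
  · exact (hP.comp (Real.continuous_sqrt.mul continuous_const)).continuousOn
  · rw [interior_Ici]
    intro a ha' b hb' hab
    have ha0 : (0:ℝ) < a := ha'
    have hb0 : (0:ℝ) < b := hb'
    rw [(ray_hasDerivAt hder s a hs ha0).deriv, (ray_hasDerivAt hder s b hs hb0).deriv]
    apply mul_lt_mul_of_pos_left _ (by positivity)
    exact ha (mul_pos (Real.sqrt_pos.2 ha0) hs) (mul_pos (Real.sqrt_pos.2 hb0) hs)
      (mul_lt_mul_of_pos_right (Real.sqrt_lt_sqrt ha0.le hab) hs)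

lemma conc_of_ratio_all {P P' : ℝ → ℝ} (hder : ∀ s, HasDerivAt P (P' s) s)
    (ha : AntitoneOn (fun σ => P' σ / σ) (Ioi 0))
    (hb : AntitoneOn (fun σ => P' (-σ) / (-σ)) (Ioi 0)) (s : ℝ) :
    ConcaveOn ℝ (Ici (0:ℝ)) (fun τ => P (√τ * s)) := by
  rcases lt_trichotomy s 0 with hs | hs | hs
  · have h1 : ∀ s, HasDerivAt (fun s => P (-s)) (- P' (-s)) s := by
      intro s
      have := (hder (-s)).comp s (hasDerivAt_neg s)
      exact this.congr_deriv (by ring)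
    have := conc_of_ratio (P := fun s => P (-s)) (P' := fun s => - P' (-s)) h1 (by
      simpa [neg_div, div_neg] using hb) (-s) (by linarith)
    simpa using this
  · subst hs
    simp only [mul_zero]
    exact concaveOn_const _ (convex_Ici 0)
  · exact conc_of_ratio hder ha s hs

/-- the nonlinearity inside -/
noncomputable def gam (q s : ℝ) : ℝ := (max s 0) ^ (q - 1)
/-- the truncated nonlinearity outside -/
noncomputable def gamb (q a s : ℝ) : ℝ := min (gam q s) (a * max s 0)
/-- primitive -/
noncomputable def prim (g : ℝ → ℝ) (y : ℝ) : ℝ := ∫ t in (0:ℝ)..y, g t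

lemma gam_cont (q : ℝ) (hq : 4 < q) : Continuous (gam q) := by
  unfold gam
  exact (continuous_id.max continuous_const).rpow_const (fun x => Or.inr (by linarith))

lemma gamb_cont (q a : ℝ) (hq : 4 < q) : Continuous (gamb q a) :=
  (gam_cont q hq).min (continuous_const.mul (continuous_id.max continuous_const))

lemma gam_nonneg (q s : ℝ) : 0 ≤ gam q s := Real.rpow_nonneg (le_max_right _ _) _

lemma gam_of_pos (q s : ℝ) (hs : 0 < s) : gam q s = s ^ (q - 2) * s := by
  rw [gam, max_eq_left hs.le]
  nth_rewrite 3 [← Real.rpow_one s]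
  rw [← Real.rpow_add hs]; congr 1; ring

lemma gam_of_nonpos (q s : ℝ) (hq : 4 < q) (hs : s ≤ 0) : gam q s = 0 := by
  rw [gam, max_eq_right hs, Real.zero_rpow (by linarith)]

lemma gamb_of_pos (q a s : ℝ) (hs : 0 < s) : gamb q a s = min (s ^ (q - 2)) a * s := by
  rw [gamb, gam_of_pos q s hs, max_eq_left hs.le, min_mul_of_nonneg _ _ hs.le]

lemma gamb_of_nonpos (q a s : ℝ) (hq : 4 < q) (hs : s ≤ 0) : gamb q a s = 0 := by
  rw [gamb, gam_of_nonpos q s hq hs, max_eq_right hs]; simp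

lemma gamb_nonneg (q a s : ℝ) (ha : 0 ≤ a) : 0 ≤ gamb q a s :=
  le_min (gam_nonneg q s) (mul_nonneg ha (le_max_right _ _))

lemma prim_hasDerivAt {g : ℝ → ℝ} (hg : Continuous g) (y : ℝ) : HasDerivAt (prim g) (g y) y :=
  (hg.integral_hasStrictDerivAt 0 y).hasDerivAt

lemma prim_zero (g : ℝ → ℝ) : prim g 0 = 0 := by simp [prim]

lemma prim_nonpos {g : ℝ → ℝ} (hg : ∀ s ≤ 0, g s = 0) (y : ℝ) (hy : y ≤ 0) : prim g y = 0 := by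
  unfold prim
  rw [intervalIntegral.integral_congr (g := fun _ => (0:ℝ))]
  · simp
  · intro t ht
    rw [uIcc_of_ge hy] at ht
    exact hg t ht.2

lemma prim_gam (q : ℝ) (hq : 4 < q) (y : ℝ) (hy : 0 ≤ y) : prim (gam q) y = y ^ q / q := by
  unfold prim
  rw [intervalIntegral.integral_congr (g := fun t => t ^ (q - 1))]
  · rw [integral_rpow (Or.inl (by linarith))]
    rw [Real.zero_rpow (by linarith)]
    simp
  · intro t ht
    rw [uIcc_of_le hy] at ht
    simp [gam, max_eq_left ht.1]

lemma prim_gamb_le (q a : ℝ) (hq : 4 < q) (ha : 0 ≤ a) (y : ℝ) :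
    prim (gamb q a) y ≤ a / 2 * y ^ 2 := by
  rcases le_total 0 y with hy | hy
  · refine le_of_deriv_le (a := prim (gamb q a)) (b := fun y => a / 2 * y ^ 2)
      (fun y => prim_hasDerivAt (gamb_cont q a hq) y)
      (fun y => (hasDerivAt_pow 2 y).const_mul (a/2)) (by simp [prim_zero]) (fun y hy => ?_) y hy
    have : gamb q a y ≤ a * max y 0 := min_le_right _ _
    rw [max_eq_left hy] at this
    simp
    linarith
  · rw [prim_nonpos (fun s hs => gamb_of_nonpos q a s hq hs) y hy]
    positivity

/-- scalar potential -/
noncomputable def pot (f g : ℝ → ℝ) (c s : ℝ) : ℝ := c / 2 * f s ^ 2 - prim g (f s)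
/-- derivative of the scalar potential -/
noncomputable def pot' (f g : ℝ → ℝ) (c s : ℝ) : ℝ := (c * f s - g (f s)) * (1 / √(1 + f s ^ 2))

section potlemmas
variable {f : ℝ → ℝ} {g : ℝ → ℝ}

lemma pot_hasDerivAt (hf₁ : Function.LeftInverse f h) (hf₂ : Function.RightInverse f h)
    (hg : Continuous g) (c s : ℝ) : HasDerivAt (pot f g c) (pot' f g c s) s := by
  have h1 := f_hasDerivAt hf₁ hf₂ s
  have h2 := ((h1.pow 2).const_mul (c/2)).sub ((prim_hasDerivAt hg (f s)).comp s h1)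
  refine h2.congr_deriv ?_
  simp [pot']; ring

lemma pot'_cont (hf₁ : Function.LeftInverse f h) (hf₂ : Function.RightInverse f h)
    (hg : Continuous g) (c : ℝ) : Continuous (pot' f g c) := by
  have := f_cont hf₁ hf₂
  unfold pot'
  refine ((continuous_const.mul this).sub (hg.comp this)).mul
    (continuous_const.div ?_ fun s => (sq1_pos _).ne')
  fun_prop

lemma pot_zero (hf₁ : Function.LeftInverse f h) (c : ℝ) : pot f g c 0 = 0 := by
  simp [pot, f_zero hf₁, prim_zero]

lemma pot_neg (hf₁ : Function.LeftInverse f h) (hf₂ : Function.RightInverse f h)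
    (hg : ∀ s ≤ 0, g s = 0) (c s : ℝ) (hc : 0 ≤ c) (hs : s ≤ 0) : 0 ≤ pot f g c s := by
  rw [pot, prim_nonpos hg _ (f_nonpos hf₁ hf₂ hs)]
  have := sq_nonneg (f s)
  nlinarith [mul_nonneg hc this]

lemma ff'_ratio (hf₁ : Function.LeftInverse f h) (hf₂ : Function.RightInverse f h) (s : ℝ)
    (hs : 0 < s) : f s * (1 / √(1 + f s ^ 2)) / s = Aq (f s) := by
  have := sq1_pos (f s)
  rw [Aq, hf₂ s]; field_simp

lemma pot'_neg_ratio (hf₁ : Function.LeftInverse f h) (hf₂ : Function.RightInverse f h)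
    (hg : ∀ s ≤ 0, g s = 0) (c : ℝ) (hc : 0 ≤ c) :
    AntitoneOn (fun σ => pot' f g c (-σ) / (-σ)) (Ioi 0) := by
  have e : ∀ s, 0 < s → pot' f g c (-s) / (-s) = c * Aq (f s) := by
    intro s hs
    rw [← ff'_ratio hf₁ hf₂ s hs, pot', hg _ (f_nonpos hf₁ hf₂ (by linarith)), f_neg hf₁ hf₂]
    have := sq1_pos (f s)
    simp; field_simp
  intro a ha b hb hab
  simp only
  rw [e a ha, e b hb]
  exact mul_le_mul_of_nonneg_left (Aq_anti (f_pos hf₁ hf₂ ha) (f_pos hf₁ hf₂ hb)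
    ((f_strictMono hf₂).monotone hab)) hc

lemma pot'_ratio_in (hf₁ : Function.LeftInverse f h) (hf₂ : Function.RightInverse f h) {q : ℝ}
    (hq : 4 < q) (c : ℝ) (hc : 0 ≤ c) :
    StrictAntiOn (fun σ => pot' f (gam q) c σ / σ) (Ioi 0) := by
  have e : ∀ s, 0 < s → pot' f (gam q) c s / s
      = c * Aq (f s) - (f s) ^ (q - 2) * Aq (f s) := by
    intro s hs
    rw [← ff'_ratio hf₁ hf₂ s hs, pot', gam_of_pos q _ (f_pos hf₁ hf₂ hs)]
    ring
  intro a ha b hb hab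
  simp only
  rw [e a ha, e b hb]
  have h1 := mul_le_mul_of_nonneg_left (Aq_anti (f_pos hf₁ hf₂ ha) (f_pos hf₁ hf₂ hb)
    ((f_strictMono hf₂).monotone hab.le)) hc
  have h2 := Cq_strict (q - 2) (by linarith) (f_pos hf₁ hf₂ ha) (f_pos hf₁ hf₂ hb)
    (f_strictMono hf₂ hab)
  simp only at h2
  linarith

lemma pot'_ratio_out (hf₁ : Function.LeftInverse f h) (hf₂ : Function.RightInverse f h) {q a : ℝ}
    (hq : 4 < q) (c : ℝ) (hc : a ≤ c) :
    AntitoneOn (fun σ => pot' f (gamb q a) c σ / σ) (Ioi 0) := by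
  have e : ∀ s, 0 < s → pot' f (gamb q a) c s / s
      = (c - min ((f s) ^ (q - 2)) a) * Aq (f s) := by
    intro s hs
    rw [← ff'_ratio hf₁ hf₂ s hs, pot', gamb_of_pos q _ _ (f_pos hf₁ hf₂ hs)]
    ring
  intro s ha t hb hab
  simp only
  rw [e s ha, e t hb]
  have hs := f_pos hf₁ hf₂ ha
  have ht := f_pos hf₁ hf₂ hb
  have hst := (f_strictMono hf₂).monotone hab
  have h1 := Aq_anti hs ht hst
  have h2 : min ((f s) ^ (q - 2)) a ≤ min ((f t) ^ (q - 2)) a :=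
    min_le_min_right _ (Real.rpow_le_rpow hs.le hst (by linarith))
  have h3 : min ((f t) ^ (q - 2)) a ≤ a := min_le_right _ _
  exact mul_le_mul (by linarith) h1 (Aq_pos _ ht).le (by linarith [min_le_right ((f s) ^ (q - 2)) a])

lemma pot_conc_in (hf₁ : Function.LeftInverse f h) (hf₂ : Function.RightInverse f h) {q : ℝ}
    (hq : 4 < q) (c : ℝ) (hc : 0 ≤ c) (s : ℝ) :
    ConcaveOn ℝ (Ici (0:ℝ)) (fun τ => pot f (gam q) c (√τ * s)) :=
  conc_of_ratio_all (pot_hasDerivAt hf₁ hf₂ (gam_cont q hq) c)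
    (pot'_ratio_in hf₁ hf₂ hq c hc).antitoneOn
    (pot'_neg_ratio hf₁ hf₂ (fun s hs => gam_of_nonpos q s hq hs) c hc) s

lemma pot_strict_in (hf₁ : Function.LeftInverse f h) (hf₂ : Function.RightInverse f h) {q : ℝ}
    (hq : 4 < q) (c : ℝ) (hc : 0 ≤ c) (s : ℝ) (hs : 0 < s) :
    StrictConcaveOn ℝ (Ici (0:ℝ)) (fun τ => pot f (gam q) c (√τ * s)) :=
  strict_conc_of_ratio (pot_hasDerivAt hf₁ hf₂ (gam_cont q hq) c)
    (pot'_ratio_in hf₁ hf₂ hq c hc) s hs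

lemma pot_conc_out (hf₁ : Function.LeftInverse f h) (hf₂ : Function.RightInverse f h) {q a : ℝ}
    (hq : 4 < q) (ha : 0 ≤ a) (c : ℝ) (hc : a ≤ c) (s : ℝ) :
    ConcaveOn ℝ (Ici (0:ℝ)) (fun τ => pot f (gamb q a) c (√τ * s)) :=
  conc_of_ratio_all (pot_hasDerivAt hf₁ hf₂ (gamb_cont q a hq) c)
    (pot'_ratio_out hf₁ hf₂ hq c hc)
    (pot'_neg_ratio hf₁ hf₂ (fun s hs => gamb_of_nonpos q a s hq hs) c (ha.trans hc)) s

lemma pot_out_ge {q a : ℝ} (hq : 4 < q) (ha : 0 ≤ a) (c s : ℝ) :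
    (c - a) / 2 * f s ^ 2 ≤ pot f (gamb q a) c s := by
  have := prim_gamb_le q a hq ha (f s)
  rw [pot]; linarith

lemma pot'_out_le {q a : ℝ} (hq : 4 < q) (ha : 0 ≤ a) (c s : ℝ) (hc : 0 ≤ c) :
    |pot' f (gamb q a) c s| ≤ c + a := by
  rw [pot', abs_mul, abs_of_pos (one_div_pos.2 (sq1_pos _))]
  have h1 : |c * f s - gamb q a (f s)| ≤ (c + a) * |f s| := by
    refine (abs_sub _ _).trans ?_
    rw [abs_mul, abs_of_nonneg hc, abs_of_nonneg (gamb_nonneg q a _ ha), add_mul]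
    gcongr
    refine (min_le_right _ _).trans ?_
    gcongr
    exact max_le (le_abs_self _) (abs_nonneg _)
  calc _ ≤ (c + a) * |f s| * (1 / √(1 + f s ^ 2)) :=
        mul_le_mul_of_nonneg_right h1 (one_div_pos.2 (sq1_pos _)).le
    _ = (c + a) * (|f s| * (1 / √(1 + f s ^ 2))) := by ring
    _ ≤ (c + a) * 1 := mul_le_mul_of_nonneg_left (abs_mul_inv_sq1 _) (by linarith)
    _ = _ := mul_one _

lemma gam_abs_le {q : ℝ} (hq : 4 < q) (y M : ℝ) (hy : |y| ≤ M) : gam q y ≤ M ^ (q - 1) := by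
  apply Real.rpow_le_rpow (le_max_right _ _) _ (by linarith)
  exact max_le ((le_abs_self _).trans hy) ((abs_nonneg _).trans hy)

lemma prim_gam_bd {q : ℝ} (hq : 4 < q) (y : ℝ) :
    0 ≤ prim (gam q) y ∧ prim (gam q) y ≤ |y| ^ q := by
  rcases le_total 0 y with hy | hy
  · rw [prim_gam q hq y hy, abs_of_nonneg hy]
    have := Real.rpow_nonneg hy q
    exact ⟨by positivity, div_le_self this (by linarith)⟩
  · rw [prim_nonpos (fun s hs => gam_of_nonpos q s hq hs) y hy]
    exact ⟨le_rfl, by positivity⟩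

lemma pot_in_bd (hf₁ : Function.LeftInverse f h) (hf₂ : Function.RightInverse f h) {q : ℝ}
    (hq : 4 < q) (c Cv M s : ℝ) (hc : 0 ≤ c) (hcv : c ≤ Cv) (hs : |s| ≤ M) :
    |pot f (gam q) c s| ≤ Cv / 2 * M ^ 2 + M ^ q ∧ |pot' f (gam q) c s| ≤ Cv * M + M ^ (q - 1) := by
  have h1 : |f s| ≤ M := (f_abs_le hf₁ hf₂ s).trans hs
  have hM : 0 ≤ M := (abs_nonneg _).trans hs
  constructor
  · rw [pot]
    refine (abs_sub _ _).trans (add_le_add ?_ ?_)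
    · rw [abs_mul, abs_of_nonneg (by positivity : 0 ≤ c / 2), abs_pow]
      have : 0 ≤ Cv / 2 := by linarith
      gcongr
    · rw [abs_of_nonneg (prim_gam_bd hq _).1]
      exact (prim_gam_bd hq _).2.trans (Real.rpow_le_rpow (abs_nonneg _) h1 (by linarith))
  · rw [pot', abs_mul, abs_of_pos (one_div_pos.2 (sq1_pos _))]
    refine (mul_le_of_le_one_right (abs_nonneg _) (inv_sq1_le _)).trans ?_
    refine (abs_sub _ _).trans (add_le_add ?_ ?_)
    · rw [abs_mul, abs_of_nonneg hc]
      gcongr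
      exact hc.trans hcv
    · rw [abs_of_nonneg (gam_nonneg q _)]
      exact gam_abs_le hq _ _ h1

lemma pot_sup (hf₁ : Function.LeftInverse f h) (hf₂ : Function.RightInverse f h) {q : ℝ}
    (hq : 4 < q) (Cv K : ℝ) (hCv : 0 ≤ Cv) (hK : 0 ≤ K) :
    ∃ s₀ : ℝ, ∀ s, s₀ ≤ s → ∀ c, c ≤ Cv → pot f (gam q) c s ≤ -K * s ^ 2 := by
  have h1 : ∀ᶠ y : ℝ in atTop, q * (Cv / 2 + 2 * K) ≤ y ^ (q - 4) :=
    (tendsto_rpow_atTop (by linarith : 0 < q - 4)).eventually_ge_atTop _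
  obtain ⟨y₀, hy₀⟩ := eventually_atTop.1 h1
  refine ⟨h (max y₀ 1), fun s hs c hc => ?_⟩
  have hy : max y₀ 1 ≤ f s := by rw [← h_strictMono.le_iff_le, hf₂]; exact hs
  have hy1 : 1 ≤ f s := (le_max_right _ _).trans hy
  have hy2 := hy₀ (f s) ((le_max_left _ _).trans hy)
  have hs1 := h_le (f s) (by linarith)
  rw [hf₂] at hs1
  have hs0 : 0 ≤ s := by
    have := h_pos (f s) (by linarith)
    rw [hf₂] at this
    exact this.le
  set y := f s
  have hs2 : s ^ 2 ≤ 2 * y ^ 4 := by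
    have : s ^ 2 ≤ (y * √(1 + y ^ 2)) ^ 2 := by gcongr
    rw [mul_pow, sq1_sq] at this
    nlinarith [mul_nonneg (sq_nonneg y) (by nlinarith : 0 ≤ y ^ 2 - 1)]
  have hyq : y ^ q = y ^ (q - 4) * y ^ 4 := by
    rw [← Real.rpow_natCast y 4, ← Real.rpow_add (by linarith)]; norm_num
  have e : pot f (gam q) c s = c / 2 * y ^ 2 - y ^ q / q := by
    rw [pot, prim_gam q hq _ (by linarith)]
  rw [e, hyq]
  have h3 : (Cv / 2 + 2 * K) * y ^ 4 ≤ y ^ (q - 4) * y ^ 4 / q := by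
    rw [le_div_iff₀ (by linarith)]
    have := mul_le_mul_of_nonneg_right hy2 (by positivity : 0 ≤ y ^ 4)
    linarith
  have h4 : c / 2 * y ^ 2 ≤ Cv / 2 * y ^ 4 := by
    have : c / 2 * y ^ 2 ≤ Cv / 2 * y ^ 2 := by gcongr
    nlinarith [mul_nonneg hCv (mul_nonneg (sq_nonneg y) (by nlinarith : 0 ≤ y ^ 2 - 1))]
  nlinarith [mul_le_mul_of_nonneg_left hs2 hK]

lemma pot_sub (hf₁ : Function.LeftInverse f h) (hf₂ : Function.RightInverse f h) {q : ℝ}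
    (hq : 4 < q) (ε : ℝ) (hε : 0 < ε) :
    ∃ δ : ℝ, 0 < δ ∧ ∀ s, |s| ≤ δ → ∀ c, 0 ≤ c → -ε * s ^ 2 ≤ pot f (gam q) c s := by
  refine ⟨min 1 ε, by positivity, fun s hs c hc => ?_⟩
  have h1 := (prim_gam_bd hq (f s)).2
  have h2 : |f s| ^ q ≤ |s| ^ q := Real.rpow_le_rpow (abs_nonneg _) (f_abs_le hf₁ hf₂ s) (by linarith)
  have h3 : |s| ^ q ≤ |s| ^ (3:ℝ) := by
    rcases eq_or_ne s 0 with h0 | h0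
    · simp [h0, Real.zero_rpow (by linarith : q ≠ 0)]
    · exact Real.rpow_le_rpow_of_exponent_ge (abs_pos.2 h0) (hs.trans (min_le_left _ _)) (by linarith)
  have h4 : |s| ^ (3:ℝ) = |s| * s ^ 2 := by
    rw [show (3:ℝ) = ((3:ℕ):ℝ) by norm_num, Real.rpow_natCast, ← sq_abs s]; ring
  have h5 : |s| * s ^ 2 ≤ ε * s ^ 2 := by
    gcongr; exact hs.trans (min_le_right _ _)
  have h6 : 0 ≤ c / 2 * f s ^ 2 := by positivity
  rw [pot]; linarith

end potlemmas
end ScalarPart2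

section RadialPart
open Set Filter Topology

/-- Data of the radial problem. -/
structure RadHyp (n : ℕ) (f : ℝ → ℝ) (q a R₁ R₂ : ℝ) (Vr : ℝ → ℝ) : Prop where
  hn : 2 ≤ n
  hf₁ : Function.LeftInverse f h
  hf₂ : Function.RightInverse f h
  hq : 4 < q
  ha : 0 < a
  hR₁ : 0 < R₁
  hR₂ : R₁ < R₂
  hVc : Continuous Vr
  hV0 : ∀ r, 0 ≤ Vr r
  hκ : ∃ κ : ℝ, 0 < κ ∧ ∀ r, 0 ≤ r → r ∉ Ioo R₁ R₂ → κ * Vr r ≤ Vr r - a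

/-- kernel function -/
noncomputable def kfun (n : ℕ) (r s : ℝ) : ℝ := if 0 < r ∧ r < s then s ^ (-(n:ℝ) / 2) else 0

lemma kfun_meas (n : ℕ) : Measurable (Function.uncurry (kfun n)) := by
  unfold Function.uncurry kfun
  refine Measurable.ite ?_ (measurable_snd.pow_const _) measurable_const
  exact (measurableSet_lt measurable_const measurable_fst).inter
    (measurableSet_lt measurable_fst measurable_snd)

lemma kfun_sq_int (n : ℕ) (hn : 2 ≤ n) (r : ℝ) : Integrable (fun s => kfun n r s ^ 2) := by
  by_cases hr : 0 < r
  · have h1 : IntegrableOn (fun s : ℝ => s ^ (-(n:ℝ))) (Ioi r) :=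
      integrableOn_Ioi_rpow_of_lt (by
        have : (2:ℝ) ≤ n := by exact_mod_cast hn
        linarith) hr
    rw [← integrable_indicator_iff measurableSet_Ioi] at h1
    refine h1.congr (Eventually.of_forall fun s => Eq.symm ?_)
    show kfun n r s ^ 2 = _
    by_cases hs : r < s
    · have hs0 : 0 < s := hr.trans hs
      rw [indicator_of_mem (show s ∈ Ioi r from hs), kfun, if_pos ⟨hr, hs⟩, ← Real.rpow_natCast,
        ← Real.rpow_mul hs0.le]
      congr 1; push_cast; ring
    · rw [indicator_of_notMem (by simpa using hs), kfun, if_neg (fun h => hs h.2)]; simp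
  · have : (fun s => kfun n r s ^ 2) = fun _ => 0 := by
      ext s; simp [kfun, hr]
    rw [this]; exact integrable_zero _ _ _

lemma kfun_memLp (n : ℕ) (hn : 2 ≤ n) (r : ℝ) : MemLp (kfun n r) 2 volume := by
  rw [memLp_two_iff_integrable_sq]
  · exact kfun_sq_int n hn r
  · exact ((kfun_meas n).comp measurable_prodMk_left).aestronglyMeasurable

/-- kernel in `L²` -/
noncomputable def kk (n : ℕ) (hn : 2 ≤ n) (r : ℝ) : Lp ℝ 2 (volume : Measure ℝ) :=
  (kfun_memLp n hn r).toLp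

lemma inner_kk (n : ℕ) (hn : 2 ≤ n) (u : Lp ℝ 2 (volume : Measure ℝ)) (r : ℝ) :
    inner ℝ u (kk n hn r) = ∫ s, u s * kfun n r s := by
  rw [L2.inner_def]
  apply integral_congr_ae
  filter_upwards [(kfun_memLp n hn r).coeFn_toLp] with s hs
  rw [kk, hs]
  simp [mul_comm]

lemma inner_kk_pos (n : ℕ) (hn : 2 ≤ n) (u : Lp ℝ 2 (volume : Measure ℝ)) (r : ℝ) (hr : 0 < r) :
    inner ℝ u (kk n hn r) = ∫ s in Ioi r, u s * s ^ (-(n:ℝ) / 2) := by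
  rw [inner_kk, ← integral_indicator measurableSet_Ioi]
  congr 1
  ext s
  by_cases hs : r < s
  · rw [indicator_of_mem (show s ∈ Ioi r from hs), kfun, if_pos ⟨hr, hs⟩]
  · rw [indicator_of_notMem (by simpa using hs), kfun, if_neg (fun h => hs h.2)]; simp

lemma int_u_k (n : ℕ) (hn : 2 ≤ n) (u : Lp ℝ 2 (volume : Measure ℝ)) (r : ℝ) (hr : 0 < r) :
    IntegrableOn (fun s => u s * s ^ (-(n:ℝ) / 2)) (Ioi r) := by
  rw [← integrable_indicator_iff measurableSet_Ioi]
  have := (Lp.memLp u).integrable_mul (kfun_memLp n hn r)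
  refine this.congr (Eventually.of_forall fun s => Eq.symm ?_)
  by_cases hs : r < s
  · rw [indicator_of_mem (show s ∈ Ioi r from hs)]; simp [kfun, hs, hr]
  · rw [indicator_of_notMem (by simpa using hs)]; simp [kfun, hs]

lemma meas_inner_kk (n : ℕ) (hn : 2 ≤ n) (u : Lp ℝ 2 (volume : Measure ℝ)) :
    Measurable fun r => inner ℝ u (kk n hn r) := by
  simp only [inner_kk]
  have : StronglyMeasurable (fun p : ℝ × ℝ => u p.2 * kfun n p.1 p.2) :=
    ((Lp.stronglyMeasurable u).comp_measurable measurable_snd).mul (kfun_meas n).stronglyMeasurable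
  exact this.integral_prod_right'.measurable

lemma norm_kk_le (n : ℕ) (hn : 2 ≤ n) (r R : ℝ) (hR : 0 < R) (hr : R ≤ r) :
    ‖kk n hn r‖ ≤ ‖kk n hn R‖ := by
  apply Lp.norm_le_norm_of_ae_le
  filter_upwards [(kfun_memLp n hn r).coeFn_toLp, (kfun_memLp n hn R).coeFn_toLp] with s h1 h2
  rw [kk, kk, h1, h2]
  by_cases hs : r < s
  · rw [kfun, kfun, if_pos ⟨hR.trans_le hr, hs⟩, if_pos ⟨hR, hr.trans_lt hs⟩]
  · rw [kfun, if_neg (fun h => hs h.2)]; simp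

/-- weight -/
noncomputable def wt (n : ℕ) (r : ℝ) : ℝ := (max r 0) ^ n

lemma wt_cont (n : ℕ) : Continuous (wt n) := (continuous_id.max continuous_const).pow n
lemma wt_nonneg (n : ℕ) (r : ℝ) : 0 ≤ wt n r := pow_nonneg (le_max_right _ _) _
lemma wt_of_pos (n : ℕ) (r : ℝ) (hr : 0 < r) : wt n r = r ^ n := by rw [wt, max_eq_left hr.le]
lemma wt_of_nonpos (n : ℕ) (hn : 2 ≤ n) (r : ℝ) (hr : r ≤ 0) : wt n r = 0 := by
  rw [wt, max_eq_right hr]; exact zero_pow (by omega)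

/-- radial potential -/
noncomputable def FF (n : ℕ) (f : ℝ → ℝ) (q a R₁ R₂ : ℝ) (Vr : ℝ → ℝ) (r s : ℝ) : ℝ :=
  wt n r * (if r ∈ Ioo R₁ R₂ then pot f (gam q) (Vr r) s else pot f (gamb q a) (Vr r) s)
/-- its derivative -/
noncomputable def FF' (n : ℕ) (f : ℝ → ℝ) (q a R₁ R₂ : ℝ) (Vr : ℝ → ℝ) (r s : ℝ) : ℝ :=
  wt n r * (if r ∈ Ioo R₁ R₂ then pot' f (gam q) (Vr r) s else pot' f (gamb q a) (Vr r) s)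
/-- dominating function -/
noncomputable def DD (n : ℕ) (a : ℝ) (Vr : ℝ → ℝ) (r : ℝ) : ℝ := wt n r * (Vr r + a)

lemma pot_meas {f g : ℝ → ℝ} (hf : Continuous f) (hg : Continuous g) {Vr : ℝ → ℝ}
    (hV : Continuous Vr) : Measurable fun p : ℝ × ℝ => pot f g (Vr p.1) p.2 := by
  have hp : Continuous (prim g) :=
    continuous_iff_continuousAt.2 fun y => (prim_hasDerivAt hg y).continuousAt
  unfold pot
  apply Continuous.measurable
  fun_prop

lemma pot'_meas {f g : ℝ → ℝ} (hf : Continuous f) (hg : Continuous g) {Vr : ℝ → ℝ}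
    (hV : Continuous Vr) : Measurable fun p : ℝ × ℝ => pot' f g (Vr p.1) p.2 := by
  unfold pot'
  apply Measurable.mul
  · apply Continuous.measurable
    fun_prop
  · apply Measurable.div measurable_const
    apply Continuous.measurable
    fun_prop

section
variable {n : ℕ} {f : ℝ → ℝ} {q a R₁ R₂ : ℝ} {Vr : ℝ → ℝ}

lemma FF_meas (H : RadHyp n f q a R₁ R₂ Vr) : Measurable (Function.uncurry (FF n f q a R₁ R₂ Vr)) := by
  have hf := f_cont H.hf₁ H.hf₂
  unfold Function.uncurry FF
  refine ((wt_cont n).measurable.comp measurable_fst).mul (Measurable.ite ?_ ?_ ?_)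
  · exact measurable_fst measurableSet_Ioo
  · exact pot_meas hf (gam_cont q H.hq) H.hVc
  · exact pot_meas hf (gamb_cont q a H.hq) H.hVc

lemma FF'_meas (H : RadHyp n f q a R₁ R₂ Vr) :
    Measurable (Function.uncurry (FF' n f q a R₁ R₂ Vr)) := by
  have hf := f_cont H.hf₁ H.hf₂
  unfold Function.uncurry FF'
  refine ((wt_cont n).measurable.comp measurable_fst).mul (Measurable.ite ?_ ?_ ?_)
  · exact measurable_fst measurableSet_Ioo
  · exact pot'_meas hf (gam_cont q H.hq) H.hVc
  · exact pot'_meas hf (gamb_cont q a H.hq) H.hVc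

lemma RadHyp.a_le (H : RadHyp n f q a R₁ R₂ Vr) (r : ℝ) (hr : 0 ≤ r) (hr' : r ∉ Ioo R₁ R₂) :
    a ≤ Vr r := by
  obtain ⟨κ, hκ, h1⟩ := H.hκ
  have := h1 r hr hr'
  have h2 := mul_nonneg hκ.le (H.hV0 r)
  linarith

lemma RadHyp.V_bdd (H : RadHyp n f q a R₁ R₂ Vr) (R : ℝ) :
    ∃ Cv : ℝ, 0 ≤ Cv ∧ ∀ r, 0 ≤ r → r ≤ R → Vr r ≤ Cv := by
  obtain ⟨C, hC⟩ := (isCompact_Icc (a := (0:ℝ)) (b := R)).exists_bound_of_continuousOn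
    H.hVc.continuousOn
  refine ⟨max C 0, le_max_right _ _, fun r h0 h1 => ?_⟩
  exact (le_abs_self _).trans ((hC r ⟨h0, h1⟩).trans (le_max_left _ _))

lemma RadHyp.varHyp (H : RadHyp n f q a R₁ R₂ Vr) :
    VarHyp (volume.restrict (Ioi (0:ℝ))) (Ioo R₁ R₂) (kk n H.hn) (FF n f q a R₁ R₂ Vr)
      (FF' n f q a R₁ R₂ Vr) (DD n a Vr) ‖kk n H.hn R₁‖ where
  hS := measurableSet_Ioo
  hSfin := ((Measure.restrict_apply_le _ _).trans_lt measure_Ioo_lt_top).ne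
  hk := meas_inner_kk n H.hn
  hB0 := norm_nonneg _
  hB := fun r hr => norm_kk_le n H.hn r R₁ H.hR₁ hr.1.le
  hFm := FF_meas H
  hder := by
    intro r s
    unfold FF FF'
    split_ifs
    · exact (pot_hasDerivAt H.hf₁ H.hf₂ (gam_cont q H.hq) _ s).const_mul _
    · exact (pot_hasDerivAt H.hf₁ H.hf₂ (gamb_cont q a H.hq) _ s).const_mul _
  hcont := by
    intro r
    unfold FF'
    split_ifs
    · exact continuous_const.mul (pot'_cont H.hf₁ H.hf₂ (gam_cont q H.hq) _)
    · exact continuous_const.mul (pot'_cont H.hf₁ H.hf₂ (gamb_cont q a H.hq) _)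
  hF0 := by
    intro r
    unfold FF
    split_ifs <;> simp [pot_zero H.hf₁]
  hout := by
    intro r hr s
    unfold FF
    rw [if_neg hr]
    rcases le_total r 0 with h0 | h0
    · rw [wt_of_nonpos n H.hn r h0, zero_mul]
    · have h1 := H.a_le r h0 hr
      have h2 := pot_out_ge (f := f) H.hq H.ha.le (Vr r) s
      have h3 : 0 ≤ (Vr r - a) / 2 * f s ^ 2 := mul_nonneg (by linarith) (sq_nonneg _)
      exact mul_nonneg (wt_nonneg _ _) (by linarith)
  hneg := by
    intro r s hs
    unfold FF
    apply mul_nonneg (wt_nonneg _ _)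
    split_ifs
    · exact pot_neg H.hf₁ H.hf₂ (fun s hs => gam_of_nonpos q s H.hq hs) _ _ (H.hV0 r) hs
    · exact pot_neg H.hf₁ H.hf₂ (fun s hs => gamb_of_nonpos q a s H.hq hs) _ _ (H.hV0 r) hs
  hconc := by
    intro r s
    unfold FF
    by_cases hr : r ∈ Ioo R₁ R₂
    · simp only [if_pos hr]
      exact (pot_conc_in H.hf₁ H.hf₂ H.hq _ (H.hV0 r) s).smul (wt_nonneg n r)
    · simp only [if_neg hr]
      rcases le_total r 0 with h0 | h0
      · simp only [wt_of_nonpos n H.hn r h0, zero_mul]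
        exact concaveOn_const _ (convex_Ici 0)
      · exact (pot_conc_out H.hf₁ H.hf₂ H.hq H.ha.le _ (H.a_le r h0 hr) s).smul (wt_nonneg n r)
  hstrict := by
    intro r hr s hs
    unfold FF
    simp only [if_pos hr]
    have hw : 0 < wt n r := by rw [wt_of_pos n r (H.hR₁.trans hr.1)]; exact pow_pos (H.hR₁.trans hr.1) n
    have h1 := pot_strict_in H.hf₁ H.hf₂ H.hq _ (H.hV0 r) s hs
    refine ⟨h1.1, fun x hx y hy hxy α β hα hβ hab => ?_⟩
    have := mul_lt_mul_of_pos_left (h1.2 hx hy hxy hα hβ hab) hw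
    simp only [smul_eq_mul] at this ⊢
    linarith
  hbd := by
    intro M
    obtain ⟨Cv, hCv0, hCv⟩ := H.V_bdd R₂
    have hR2 : 0 < R₂ := H.hR₁.trans H.hR₂
    refine ⟨R₂ ^ n * (Cv / 2 * M ^ 2 + |M| ^ q + Cv * |M| + |M| ^ (q - 1)), fun r hr s hs => ?_⟩
    have hr0 : 0 < r := H.hR₁.trans hr.1
    have hM : 0 ≤ M := (abs_nonneg _).trans hs
    have h1 := pot_in_bd H.hf₁ H.hf₂ H.hq (Vr r) Cv M s (H.hV0 r) (hCv r hr0.le hr.2.le) hs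
    unfold FF FF'
    simp only [if_pos hr, abs_mul, abs_of_nonneg (pow_nonneg hr0.le n), wt_of_pos n r hr0,
      abs_of_nonneg hM]
    have hw : r ^ n ≤ R₂ ^ n := by gcongr; exact hr.2.le
    have i1 : 0 ≤ M ^ q := Real.rpow_nonneg hM _
    have i2 : 0 ≤ M ^ (q - 1) := Real.rpow_nonneg hM _
    have i3 : 0 ≤ Cv * M := by positivity
    have i4 : 0 ≤ Cv / 2 * M ^ 2 := by positivity
    constructor
    · exact mul_le_mul hw (by linarith [h1.1]) (abs_nonneg _) (by positivity)
    · exact mul_le_mul hw (by linarith [h1.2]) (abs_nonneg _) (by positivity)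
  hD := by
    intro r hr s
    unfold FF' DD
    rw [if_neg hr, abs_mul, abs_of_nonneg (wt_nonneg n r)]
    exact mul_le_mul_of_nonneg_left (pot'_out_le H.hq H.ha.le _ _ (H.hV0 r)) (wt_nonneg n r)
  hsup := by
    intro K
    obtain ⟨Cv, hCv0, hCv⟩ := H.V_bdd R₂
    have hR1 : 0 < R₁ ^ n := pow_pos H.hR₁ n
    obtain ⟨s₀, hs₀⟩ := pot_sup H.hf₁ H.hf₂ H.hq Cv (|K| / R₁ ^ n) hCv0 (by positivity)
    refine ⟨s₀, fun r hr s hs => ?_⟩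
    have hr0 : 0 < r := H.hR₁.trans hr.1
    have h1 := hs₀ s hs (Vr r) (hCv r hr0.le hr.2.le)
    unfold FF
    rw [if_pos hr, wt_of_pos n r hr0]
    have hw : R₁ ^ n ≤ r ^ n := by
      have := H.hR₁.le
      gcongr; exact hr.1.le
    calc r ^ n * pot f (gam q) (Vr r) s ≤ r ^ n * (-(|K| / R₁ ^ n) * s ^ 2) :=
          mul_le_mul_of_nonneg_left h1 (by positivity)
      _ ≤ R₁ ^ n * (-(|K| / R₁ ^ n) * s ^ 2) := by
          apply mul_le_mul_of_nonpos_right hw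
          have : 0 ≤ (|K| / R₁ ^ n) * s ^ 2 := by positivity
          linarith
      _ = -|K| * s ^ 2 := by field_simp
      _ ≤ -K * s ^ 2 := by
          apply mul_le_mul_of_nonneg_right _ (sq_nonneg s)
          linarith [le_abs_self K]
  hsub := by
    intro ε hε
    have hR2 : 0 < R₂ ^ n := pow_pos (H.hR₁.trans H.hR₂) n
    obtain ⟨δ, hδ, h1⟩ := pot_sub H.hf₁ H.hf₂ H.hq (ε / R₂ ^ n) (by positivity)
    refine ⟨δ, hδ, fun r hr s hs => ?_⟩
    have hr0 : 0 < r := H.hR₁.trans hr.1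
    have h2 := h1 s hs (Vr r) (H.hV0 r)
    unfold FF
    rw [if_pos hr, wt_of_pos n r hr0]
    have hw : r ^ n ≤ R₂ ^ n := by gcongr; exact hr.2.le
    calc -ε * s ^ 2 = R₂ ^ n * (-(ε / R₂ ^ n) * s ^ 2) := by field_simp
      _ ≤ r ^ n * (-(ε / R₂ ^ n) * s ^ 2) := by
          apply mul_le_mul_of_nonpos_right hw
          have : 0 ≤ (ε / R₂ ^ n) * s ^ 2 := by positivity
          linarith
      _ ≤ _ := mul_le_mul_of_nonneg_left h2 (by positivity)

end
end RadialPart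

section RadialPart2
open Set Filter Topology

lemma prim0_eq {G : ℝ → ℝ} (hG0 : ∀ r ≤ 0, G r = 0) (s T : ℝ) (hs : s ≤ T) :
    ∫ r in (0:ℝ)..s, G r = ∫ r, (if r < s then (Ioc 0 T).indicator G r else 0) := by
  rcases le_or_gt s 0 with h0 | h0
  · rw [intervalIntegral.integral_congr (g := fun _ => (0:ℝ))]
    · rw [intervalIntegral.integral_zero]
      symm
      refine integral_eq_zero_of_ae (Eventually.of_forall fun r => ?_)
      show (if r < s then (Ioc 0 T).indicator G r else 0) = 0
      split_ifs with h1
      · rw [indicator_of_notMem]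
        intro h2; linarith [h2.1]
      · rfl
    · intro r hr
      rw [uIcc_of_ge h0] at hr
      exact hG0 r hr.2
  · rw [intervalIntegral.integral_of_le h0.le, integral_Ioc_eq_integral_Ioo,
      ← integral_indicator measurableSet_Ioo]
    congr 1; ext r
    by_cases h1 : r < s
    · rw [if_pos h1]
      by_cases h2 : 0 < r
      · rw [indicator_of_mem (show r ∈ Ioo 0 s from ⟨h2, h1⟩),
          indicator_of_mem (show r ∈ Ioc 0 T from ⟨h2, by linarith⟩)]
      · rw [indicator_of_notMem (fun h => h2 h.1), indicator_of_notMem (fun h => h2 h.1)]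
    · rw [if_neg h1, indicator_of_notMem (fun h => h1 h.2)]

lemma cs_bound {η : ℝ → ℝ} (hs : HasCompactSupport η) : ∃ T : ℝ, 0 < T ∧ ∀ s, T ≤ |s| → η s = 0 := by
  obtain ⟨R, hR⟩ := hs.isCompact.isBounded.subset_closedBall (0:ℝ)
  refine ⟨max (R + 1) 1, by positivity, fun s h1 => ?_⟩
  by_contra hne
  have h2 := hR (subset_tsupport η hne)
  rw [mem_closedBall_zero_iff, Real.norm_eq_abs] at h2
  have := le_max_left (R+1) 1
  linarith

lemma tri_fubini {G η : ℝ → ℝ} (hG : LocallyIntegrable G) (hG0 : ∀ r ≤ 0, G r = 0)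
    (hη : Continuous η) (hs : HasCompactSupport η) :
    ∫ r, G r * ∫ s in Ioi r, η s = ∫ s, η s * ∫ r in (0:ℝ)..s, G r := by
  obtain ⟨T, hT, hηT⟩ := cs_bound hs
  have hηi : Integrable η := hη.integrable_of_hasCompactSupport hs
  have hGi : Integrable ((Ioc 0 T).indicator G) := by
    rw [integrable_indicator_iff measurableSet_Ioc]
    exact (hG.integrableOn_isCompact isCompact_Icc).mono_set Ioc_subset_Icc_self
  have hprod : Integrable (Function.uncurry fun r s => if r < s then
      (Ioc 0 T).indicator G r * η s else 0) (volume.prod volume) := by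
    have := (hGi.mul_prod hηi).indicator (measurableSet_lt measurable_fst measurable_snd
      : MeasurableSet {p : ℝ × ℝ | p.1 < p.2})
    refine this.congr (Eventually.of_forall fun p => ?_)
    simp [indicator, Function.uncurry]
  have hsw := integral_integral_swap hprod
  have e1 : ∀ r, G r * ∫ s in Ioi r, η s = ∫ s, if r < s then (Ioc 0 T).indicator G r * η s else 0 := by
    intro r
    rw [← integral_indicator measurableSet_Ioi, ← integral_const_mul]
    congr 1; ext s
    by_cases h1 : r < s
    · rw [if_pos h1, indicator_of_mem (show s ∈ Ioi r from h1)]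
      by_cases h2 : r ≤ T
      · by_cases h3 : 0 < r
        · rw [indicator_of_mem (show r ∈ Ioc 0 T from ⟨h3, h2⟩)]
        · rw [indicator_of_notMem (fun h => h3 h.1), hG0 r (not_lt.1 h3)]
      · rw [hηT s (by rw [abs_of_pos] <;> linarith)]; simp
    · rw [if_neg h1, indicator_of_notMem (by simpa using h1), mul_zero]
  have e2 : ∀ s, η s * ∫ r in (0:ℝ)..s, G r = ∫ r, if r < s then (Ioc 0 T).indicator G r * η s else 0 := by
    intro s
    by_cases h1 : s ≤ T
    · rw [prim0_eq hG0 s T h1, ← integral_const_mul]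
      congr 1; ext r
      split_ifs <;> ring
    · have : η s = 0 := hηT s (by rw [abs_of_pos] <;> linarith)
      simp [this]
  simp only [e1, e2]
  exact hsw

/-- test vector -/
noncomputable def tst (n : ℕ) (η : ℝ → ℝ) (s : ℝ) : ℝ := η s * (max s 0) ^ ((n:ℝ) / 2)

lemma mx_cont (n : ℕ) : Continuous fun s : ℝ => (max s 0) ^ ((n:ℝ) / 2) :=
  (continuous_id.max continuous_const).rpow_const (fun x => Or.inr (by positivity))

lemma tst_memLp (n : ℕ) {η : ℝ → ℝ} (hη : Continuous η) (hs : HasCompactSupport η) :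
    MemLp (tst n η) 2 volume := by
  apply Continuous.memLp_of_hasCompactSupport
  · exact hη.mul (mx_cont n)
  · exact hs.mul_right

lemma tst_inner (n : ℕ) {η : ℝ → ℝ} (hη : Continuous η) (hs : HasCompactSupport η)
    (u : Lp ℝ 2 (volume : Measure ℝ)) :
    inner ℝ u ((tst_memLp n hη hs).toLp) = ∫ s, η s * (u s * (max s 0) ^ ((n:ℝ) / 2)) := by
  rw [L2.inner_def]
  apply integral_congr_ae
  filter_upwards [(tst_memLp n hη hs).coeFn_toLp] with s h1
  rw [h1, tst]
  simp; ring

lemma tst_kk (n : ℕ) (hn : 2 ≤ n) {η : ℝ → ℝ} (hη : Continuous η) (hs : HasCompactSupport η)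
    (r : ℝ) (hr : 0 < r) : inner ℝ ((tst_memLp n hη hs).toLp) (kk n hn r) = ∫ s in Ioi r, η s := by
  rw [inner_kk_pos n hn _ r hr]
  apply integral_congr_ae
  filter_upwards [ae_restrict_of_ae (tst_memLp n hη hs).coeFn_toLp, ae_restrict_mem measurableSet_Ioi]
    with s h1 h2
  have h3 : 0 < s := hr.trans h2
  rw [h1, tst, max_eq_left h3.le, mul_assoc, ← Real.rpow_add h3]
  simp [neg_div]

section
variable {n : ℕ} {f : ℝ → ℝ} {q a R₁ R₂ : ℝ} {Vr : ℝ → ℝ}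

lemma tst_D (H : RadHyp n f q a R₁ R₂ Vr) {η : ℝ → ℝ} (hη : Continuous η)
    (hs : HasCompactSupport η) :
    IntegrableOn (fun r => DD n a Vr r * |inner ℝ ((tst_memLp n hη hs).toLp) (kk n H.hn r)|)
      (Ioo R₁ R₂)ᶜ (volume.restrict (Ioi (0:ℝ))) := by
  apply Integrable.integrableOn
  have hηi : Integrable η := hη.integrable_of_hasCompactSupport hs
  obtain ⟨T, hT, hηT⟩ := cs_bound hs
  have hDc : Continuous (DD n a Vr) := (wt_cont n).mul (H.hVc.add continuous_const)
  have h1 : IntegrableOn (fun r => |DD n a Vr r| * ∫ s, |η s|) (Ioc 0 T) :=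
    ((hDc.abs.mul continuous_const).integrableOn_Icc).mono_set Ioc_subset_Icc_self
  rw [← integrable_indicator_iff measurableSet_Ioc] at h1
  refine (h1.restrict (s := Ioi 0)).mono' ?_ ?_
  · exact (hDc.measurable.mul (meas_inner_kk n H.hn _).abs).aestronglyMeasurable
  · filter_upwards [ae_restrict_mem measurableSet_Ioi] with r hr
    rw [tst_kk n H.hn hη hs r hr, norm_mul, Real.norm_eq_abs, Real.norm_eq_abs, abs_abs]
    by_cases h2 : r ≤ T
    · rw [indicator_of_mem (show r ∈ Ioc 0 T from ⟨hr, h2⟩)]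
      apply mul_le_mul_of_nonneg_left _ (abs_nonneg _)
      refine (norm_integral_le_integral_norm (fun s => η s)).trans ?_
      exact setIntegral_le_integral hηi.norm (Eventually.of_forall fun s => norm_nonneg _)
    · have : ∫ s in Ioi r, η s = 0 := by
        rw [setIntegral_congr_fun measurableSet_Ioi (g := fun _ => (0:ℝ))]
        · simp
        · intro s hs'
          have h3 : r < s := hs'
          exact hηT s (by rw [abs_of_pos] <;> linarith)
      rw [this, indicator_of_notMem (fun h => h2 h.2)]; simp

lemma FF'_nonpos (H : RadHyp n f q a R₁ R₂ Vr) (r s : ℝ) (hr : r ≤ 0) :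
    FF' n f q a R₁ R₂ Vr r s = 0 := by
  rw [FF', wt_of_nonpos n H.hn r hr, zero_mul]

/-- Pointwise bound on the derivative. -/
lemma FF'_bd (H : RadHyp n f q a R₁ R₂ Vr) (M R : ℝ) :
    ∃ C : ℝ, 0 ≤ C ∧ ∀ r, 0 ≤ r → r ≤ R → ∀ s, (r ∈ Ioo R₁ R₂ → |s| ≤ M) →
      |FF' n f q a R₁ R₂ Vr r s| ≤ C * r ^ n := by
  obtain ⟨Cv, hCv0, hCv⟩ := H.V_bdd R
  have ha := H.ha
  refine ⟨Cv + a + Cv * |M| + |M| ^ (q - 1), by positivity, fun r hr hrR s hs => ?_⟩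
  have hw : wt n r = r ^ n := by rw [wt, max_eq_left hr]
  rw [FF', abs_mul, abs_of_nonneg (wt_nonneg n r), hw, mul_comm]
  apply mul_le_mul_of_nonneg_right _ (pow_nonneg hr n)
  have i1 : 0 ≤ Cv * |M| := by positivity
  have i2 : 0 ≤ |M| ^ (q - 1) := by positivity
  split_ifs with h1
  · have := (pot_in_bd H.hf₁ H.hf₂ H.hq (Vr r) Cv |M| s (H.hV0 r) (hCv r hr hrR)
      ((hs h1).trans (le_abs_self M))).2
    linarith
  · have := pot'_out_le (f := f) H.hq H.ha.le (Vr r) s (H.hV0 r)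
    have h2 := hCv r hr hrR
    linarith

end
end RadialPart2

section RadialPart3
open Set Filter Topology
variable {n : ℕ} {f : ℝ → ℝ} {q a R₁ R₂ : ℝ} {Vr : ℝ → ℝ}

lemma RadHyp.exists_u (H : RadHyp n f q a R₁ R₂ Vr) :
    ∃ u : Lp ℝ 2 (volume : Measure ℝ),
      IntegrableOn (fun r => FF n f q a R₁ R₂ Vr r (inner ℝ u (kk n H.hn r))) (Ioi 0) ∧
      (∃ r ∈ Ioo R₁ R₂, 0 < inner ℝ u (kk n H.hn r)) ∧
      ∀ η : ℝ → ℝ, Continuous η → HasCompactSupport η →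
        (∫ s, η s * (u s * (max s 0) ^ ((n:ℝ) / 2))) +
          ∫ r, FF' n f q a R₁ R₂ Vr r (inner ℝ u (kk n H.hn r)) * (∫ s in Ioi r, η s) = 0 := by
  -- starting vector
  have hR := H.hR₁
  have hRR := H.hR₂
  let b : ContDiffBump ((R₁ + R₂) / 2 : ℝ) :=
    ⟨(R₂ - R₁) / 4, (R₂ - R₁) / 2, by linarith, by linarith⟩
  have hb1 : ContDiff ℝ 1 (b : ℝ → ℝ) := b.contDiff
  have hbs : HasCompactSupport (b : ℝ → ℝ) := b.hasCompactSupport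
  have hsupp : Function.support (b : ℝ → ℝ) = Ioo R₁ R₂ := by
    rw [b.support_eq, Real.ball_eq_Ioo]
    congr 1 <;> simp only [b] <;> ring
  set η₀ : ℝ → ℝ := fun s => - deriv (b : ℝ → ℝ) s with hη₀
  have hη₀c : Continuous η₀ := (hb1.continuous_deriv le_rfl).neg
  have hη₀s : HasCompactSupport η₀ := hbs.deriv.neg
  have hη₀i : ∀ r, ∫ s in Ioi r, η₀ s = b r := by
    intro r
    rw [hη₀, integral_neg, hbs.integral_Ioi_deriv_eq hb1, neg_neg]
  set u₀ : Lp ℝ 2 (volume : Measure ℝ) := (tst_memLp n hη₀c hη₀s).toLp with hu₀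
  have hu₀v : ∀ r, 0 < r → inner ℝ u₀ (kk n H.hn r) = b r := by
    intro r hr
    rw [hu₀, tst_kk n H.hn hη₀c hη₀s r hr, hη₀i]
  have hy := H.varHyp
  have hintg : Integrable (fun r => FF n f q a R₁ R₂ Vr r (inner ℝ u₀ (kk n H.hn r)))
      (volume.restrict (Ioi 0)) := by
    obtain ⟨C, hC⟩ := hy.hbd 1
    have h1 : Integrable ((Ioo R₁ R₂).indicator fun _ => C) (volume.restrict (Ioi (0:ℝ))) := by
      rw [integrable_indicator_iff measurableSet_Ioo]
      exact integrableOn_const hy.hSfin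
    refine h1.mono' (hy.measF (hy.hk u₀)).aestronglyMeasurable ?_
    filter_upwards [ae_restrict_mem measurableSet_Ioi] with r hr
    rw [hu₀v r hr]
    by_cases h2 : r ∈ Ioo R₁ R₂
    · rw [indicator_of_mem h2]
      exact (hC r h2 (b r) (by rw [abs_of_nonneg b.nonneg]; exact b.le_one)).1
    · rw [indicator_of_notMem h2]
      have : b r = 0 := by
        rw [← hsupp] at h2
        exact Function.notMem_support.1 h2
      rw [this, hy.hF0]; simp
  have hpos : (volume.restrict (Ioi (0:ℝ))) {r | r ∈ Ioo R₁ R₂ ∧ 0 < inner ℝ u₀ (kk n H.hn r)} ≠ 0 := by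
    have hsub : Ioo R₁ R₂ ⊆ {r | r ∈ Ioo R₁ R₂ ∧ 0 < inner ℝ u₀ (kk n H.hn r)} := by
      intro r hr
      refine ⟨hr, ?_⟩
      rw [hu₀v r (hR.trans hr.1)]
      have : r ∈ Function.support (b : ℝ → ℝ) := by rw [hsupp]; exact hr
      exact lt_of_le_of_ne b.nonneg (Ne.symm this)
    have hp : 0 < (volume.restrict (Ioi (0:ℝ))) (Ioo R₁ R₂) := by
      rw [Measure.restrict_apply measurableSet_Ioo, inter_eq_left.2 (show Ioo R₁ R₂ ⊆ Ioi 0 from fun r hr => hR.trans hr.1)]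
      simp [hRR]
    exact (hp.trans_le (measure_mono hsub)).ne'
  have : Fact ((2:ENNReal) ≠ ⊤) := ⟨by norm_num⟩
  obtain ⟨u, h1, h2, h3⟩ := hy.exists_crit u₀ hintg hpos
  refine ⟨u, h1, h2, fun η hη hs => ?_⟩
  have h4 := h3 _ (tst_D H hη hs)
  rw [tst_inner n hη hs] at h4
  refine Eq.trans ?_ h4
  congr 1
  rw [← integral_indicator measurableSet_Ioi]
  congr 1
  ext r
  by_cases hr : 0 < r
  · rw [indicator_of_mem (show r ∈ Ioi 0 from hr), tst_kk n H.hn hη hs r hr]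
  · rw [indicator_of_notMem (by simpa using hr), FF'_nonpos H r _ (not_lt.1 hr), zero_mul]

/-- The one dimensional problem solved. -/
theorem RadHyp.radial_exists (H : RadHyp n f q a R₁ R₂ Vr) :
    ∃ vf pt : ℝ → ℝ, (∀ r, HasDerivAt vf (pt r) r) ∧ Continuous pt ∧ (∀ r ≤ 0, pt r = 0) ∧
      (∃ r ∈ Ioo R₁ R₂, 0 < vf r) ∧
      IntegrableOn (fun r => r ^ n * pt r ^ 2) (Ioi 0) ∧
      IntegrableOn (fun r => r ^ n * (Vr r * f (vf r) ^ 2)) (Ioi 0) ∧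
      ∀ Φ : ℝ → ℝ, ContDiff ℝ 1 Φ → HasCompactSupport Φ →
        ∫ r in Ioi 0, (r ^ n * (pt r * deriv Φ r) + FF' n f q a R₁ R₂ Vr r (vf r) * Φ r) = 0 := by
  obtain ⟨u, hu1, ⟨r₀, hr₀, hur₀⟩, hu3⟩ := H.exists_u
  have hy := H.varHyp
  have hR := H.hR₁
  set vv : ℝ → ℝ := fun r => inner ℝ u (kk n H.hn r) with hvv
  have hvm : Measurable vv := meas_inner_kk n H.hn u
  set M := ‖u‖ * ‖kk n H.hn R₁‖ with hM
  have hvM : ∀ r ∈ Ioo R₁ R₂, |vv r| ≤ M := fun r hr =>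
    (abs_real_inner_le_norm _ _).trans (mul_le_mul_of_nonneg_left (hy.hB r hr) (norm_nonneg _))
  set G : ℝ → ℝ := fun r => FF' n f q a R₁ R₂ Vr r (vv r) with hG
  have hGm : Measurable G := (FF'_meas H).comp (measurable_id.prodMk hvm)
  have hG0 : ∀ r ≤ 0, G r = 0 := fun r hr => FF'_nonpos H r _ hr
  have hGb : ∀ R : ℝ, ∃ C : ℝ, 0 ≤ C ∧ ∀ r, 0 ≤ r → r ≤ R → |G r| ≤ C * r ^ n := by
    intro R
    obtain ⟨C, hC0, hC⟩ := FF'_bd H M R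
    exact ⟨C, hC0, fun r h0 h1 => hC r h0 h1 _ (hvM r)⟩
  have hGl : LocallyIntegrable G := by
    rw [locallyIntegrable_iff]
    intro K hK
    obtain ⟨R, hR'⟩ := hK.isBounded.subset_closedBall (0:ℝ)
    obtain ⟨C, hC0, hC⟩ := hGb R
    refine Measure.integrableOn_of_bounded (M := C * |R| ^ n) hK.measure_lt_top.ne
      hGm.aestronglyMeasurable ?_
    filter_upwards [ae_restrict_mem hK.measurableSet] with r hr
    have h1 := hR' hr
    rw [mem_closedBall_zero_iff, Real.norm_eq_abs] at h1
    rcases le_total r 0 with h0 | h0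
    · rw [hG0 r h0, norm_zero]; positivity
    · rw [abs_of_nonneg h0] at h1
      refine (hC r h0 h1).trans ?_
      gcongr
      exact h1.trans (le_abs_self R)
  set Q : ℝ → ℝ := fun s => ∫ r in (0:ℝ)..s, G r with hQ
  have hQc : Continuous Q := intervalIntegral.continuous_primitive
    (fun x y => (hGl.integrableOn_isCompact isCompact_uIcc).intervalIntegrable) 0
  have hQ0 : ∀ s ≤ 0, Q s = 0 := by
    intro s hs
    simp only [hQ]
    rw [intervalIntegral.integral_congr (g := fun _ => (0:ℝ))]
    · simp
    · intro r hr
      rw [uIcc_of_ge hs] at hr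
      exact hG0 r hr.2
  have hQb : ∃ C : ℝ, 0 ≤ C ∧ ∀ s, 0 ≤ s → s ≤ 1 → |Q s| ≤ C * s ^ (n + 1) := by
    obtain ⟨C, hC0, hC⟩ := hGb 1
    refine ⟨C, hC0, fun s h0 h1 => ?_⟩
    have := intervalIntegral.norm_integral_le_of_norm_le_const (a := 0) (b := s) (f := G)
      (C := C * s ^ n) (by
        intro r hr
        rw [uIoc_of_le h0] at hr
        refine (hC r hr.1.le (hr.2.trans h1)).trans ?_
        have := hr.1.le
        gcongr
        exact hr.2)
    rw [sub_zero, abs_of_nonneg h0] at this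
    rw [pow_succ, ← mul_assoc]
    exact this
  -- identification of u
  have hW : ∀ᵐ s, u s * (max s 0) ^ ((n:ℝ) / 2) + Q s = 0 := by
    apply ae_eq_zero_of_integral_contDiff_smul_eq_zero (μ := (volume : Measure ℝ))
    · have h1 : LocallyIntegrable (fun s => u s * (max s 0) ^ ((n:ℝ) / 2)) (volume : Measure ℝ) := by
        have h2 : LocallyIntegrable u (volume : Measure ℝ) := (Lp.memLp u).locallyIntegrable (by norm_num)
        rw [locallyIntegrable_iff] at h2 ⊢
        intro K hK
        exact (h2 K hK).mul_continuousOn (mx_cont n).continuousOn hK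
      exact h1.add hQc.locallyIntegrable
    · intro g hg hgs
      have h1 := hu3 g hg.continuous hgs
      rw [tri_fubini hGl hG0 hg.continuous hgs] at h1
      refine Eq.trans ?_ h1
      rw [← integral_add]
      · congr 1; ext s; simp only [smul_eq_mul, hQ]; ring
      · have := (tst_memLp n hg.continuous hgs).integrable_mul (Lp.memLp u)
        refine this.congr (Eventually.of_forall fun s => ?_)
        simp [tst]; ring
      · exact (hg.continuous.mul hQc).integrable_of_hasCompactSupport hgs.mul_right
  set pt : ℝ → ℝ := fun s => Q s / (max s 0) ^ n with hpt
  have hpt0 : ∀ r ≤ 0, pt r = 0 := fun r hr => by simp only [hpt, hQ0 r hr, zero_div]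
  have hptc : Continuous pt := by
    rw [continuous_iff_continuousAt]
    intro s
    rcases lt_trichotomy s 0 with hs | hs | hs
    · have : pt =ᶠ[𝓝 s] fun _ => 0 := by
        filter_upwards [Iio_mem_nhds hs] with r hr
        exact hpt0 r (le_of_lt hr)
      exact (continuousAt_const).congr this.symm
    · subst hs
      obtain ⟨C, hC0, hC⟩ := hQb
      rw [ContinuousAt, hpt0 0 le_rfl]
      have hz : Tendsto (fun s : ℝ => C * |s|) (𝓝 0) (𝓝 0) := by
        have : Continuous (fun s : ℝ => C * |s|) := by fun_prop
        simpa using this.tendsto 0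
      refine squeeze_zero_norm' ?_ hz
      filter_upwards [Iio_mem_nhds (zero_lt_one : (0:ℝ) < 1)] with r hr
      rcases le_or_gt r 0 with h0 | h0
      · rw [hpt0 r h0, norm_zero]; positivity
      · simp only [hpt]
        rw [max_eq_left h0.le, norm_div, norm_pow, Real.norm_eq_abs, Real.norm_eq_abs, abs_of_pos h0,
          div_le_iff₀ (by positivity)]
        have := hC r h0.le (le_of_lt hr)
        rwa [pow_succ', ← mul_assoc] at this
    · refine hQc.continuousAt.div ?_ ?_
      · exact ((continuous_id.max continuous_const).pow n).continuousAt
      · rw [max_eq_left hs.le]; positivity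
  have hQpt : ∀ r, 0 < r → Q r = r ^ n * pt r := by
    intro r hr
    simp only [hpt]
    rw [max_eq_left hr.le]
    field_simp
  -- u in terms of pt
  have hup : ∀ᵐ s, 0 < s → u s = - (pt s * s ^ ((n:ℝ) / 2)) := by
    filter_upwards [hW] with s hs h0
    rw [hQpt s h0, max_eq_left h0.le] at hs
    have h1 : s ^ n = s ^ ((n:ℝ) / 2) * s ^ ((n:ℝ) / 2) := by
      rw [← Real.rpow_add h0, add_halves, Real.rpow_natCast]
    have h2 : 0 < s ^ ((n:ℝ) / 2) := Real.rpow_pos_of_pos h0 _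
    rw [h1] at hs
    have : (u s + pt s * s ^ ((n:ℝ) / 2)) * s ^ ((n:ℝ) / 2) = 0 := by linarith
    rcases mul_eq_zero.1 this with h3 | h3
    · linarith
    · exact absurd h3 h2.ne'
  have hpi : ∀ x y, IntervalIntegrable pt volume x y := fun x y => hptc.intervalIntegrable x y
  set vf : ℝ → ℝ := fun r => vv 1 + ∫ s in (1:ℝ)..r, pt s with hvf
  have hvfd : ∀ r, HasDerivAt vf (pt r) r := fun r =>
    ((hptc.integral_hasStrictDerivAt 1 r).hasDerivAt).const_add _
  have hvfv : ∀ r, 0 < r → vf r = vv r := by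
    intro r hr
    have h1 := intervalIntegral.integral_Ioi_sub_Ioi' (int_u_k n H.hn u 1 one_pos) (int_u_k n H.hn u r hr)
    rw [← inner_kk_pos n H.hn u 1 one_pos, ← inner_kk_pos n H.hn u r hr] at h1
    have h2 : ∫ s in (1:ℝ)..r, u s * s ^ (-(n:ℝ) / 2) = ∫ s in (1:ℝ)..r, - pt s := by
      apply intervalIntegral.integral_congr_ae
      filter_upwards [hup] with s hs h3
      have h4 : 0 < s := by
        have := h3.1
        exact (lt_min one_pos hr).trans this
      rw [hs h4, neg_mul, mul_assoc, ← Real.rpow_add h4]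
      simp [neg_div]
    rw [h2, intervalIntegral.integral_neg] at h1
    simp only [hvf, hvv]
    linarith
  have hvfc : Continuous vf := continuous_iff_continuousAt.2 fun r => (hvfd r).continuousAt
  have hfc := f_cont H.hf₁ H.hf₂
  refine ⟨vf, pt, hvfd, hptc, hpt0, ⟨r₀, hr₀, ?_⟩, ?_, ?_, ?_⟩
  · rw [hvfv r₀ (hR.trans hr₀.1)]; exact hur₀
  · have h1 : Integrable (fun s => u s ^ 2) := (Lp.memLp u).integrable_sq
    refine (h1.integrableOn (s := Ioi 0)).congr ?_
    filter_upwards [ae_restrict_of_ae hup, ae_restrict_mem measurableSet_Ioi] with s h2 h3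
    have h0 : 0 < s := h3
    have h1 : s ^ n = s ^ ((n:ℝ) / 2) * s ^ ((n:ℝ) / 2) := by
      rw [← Real.rpow_add h0, add_halves, Real.rpow_natCast]
    rw [h2 h0, h1]; ring
  · obtain ⟨κ, hκ, hκ2⟩ := H.hκ
    obtain ⟨Cv, hCv0, hCv⟩ := H.V_bdd R₂
    have i1 := hu1.norm.const_mul (2 / κ)
    have i2 : Integrable ((Ioo R₁ R₂).indicator fun _ => R₂ ^ n * (Cv * M ^ 2))
        (volume.restrict (Ioi (0:ℝ))) := by
      rw [integrable_indicator_iff measurableSet_Ioo]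
      exact integrableOn_const hy.hSfin
    refine (i1.add i2).mono' ?_ ?_
    · exact (((continuous_id.pow n).mul
        (H.hVc.mul ((hfc.comp hvfc).pow 2))).measurable).aestronglyMeasurable
    · filter_upwards [ae_restrict_mem measurableSet_Ioi] with r hr
      have h0 : 0 < r := hr
      have hV := H.hV0 r
      rw [hvfv r h0, Real.norm_of_nonneg (by positivity)]
      simp only [Pi.add_apply]
      by_cases h2 : r ∈ Ioo R₁ R₂
      · rw [indicator_of_mem h2]
        have hfM : f (vv r) ^ 2 ≤ M ^ 2 := by
          rw [← sq_abs]
          have := (f_abs_le H.hf₁ H.hf₂ (vv r)).trans (hvM r h2)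
          gcongr
        have h3 : r ^ n * (Vr r * f (vv r) ^ 2) ≤ R₂ ^ n * (Cv * M ^ 2) := by
          have := h2.2.le
          have := hCv r h0.le h2.2.le
          have hR2 : 0 ≤ R₂ := by linarith
          gcongr
        have h4 : 0 ≤ 2 / κ * ‖FF n f q a R₁ R₂ Vr r (inner ℝ u (kk n H.hn r))‖ := by positivity
        linarith
      · rw [indicator_of_notMem h2, add_zero, Real.norm_of_nonneg (hy.hout r h2 _), FF, if_neg h2,
          wt_of_pos n r h0]
        have h3 := pot_out_ge (f := f) H.hq H.ha.le (Vr r) (vv r)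
        have h4 := hκ2 r h0.le h2
        have h5 : κ * Vr r / 2 * f (vv r) ^ 2 ≤ (Vr r - a) / 2 * f (vv r) ^ 2 := by gcongr
        have h6 : Vr r * f (vv r) ^ 2 ≤ 2 / κ * pot f (gamb q a) (Vr r) (vv r) := by
          rw [div_mul_eq_mul_div, le_div_iff₀ hκ]
          linarith
        calc r ^ n * (Vr r * f (vv r) ^ 2) ≤ r ^ n * (2 / κ * pot f (gamb q a) (Vr r) (vv r)) := by gcongr
          _ = _ := by ring
  · intro Φ hΦ hΦs
    have hd := hΦ.continuous_deriv le_rfl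
    have h1 := tri_fubini hGl hG0 hd hΦs.deriv
    simp only [hΦs.integral_Ioi_deriv_eq hΦ] at h1
    have h2 : ∫ r in Ioi 0, (r ^ n * (pt r * deriv Φ r) + FF' n f q a R₁ R₂ Vr r (vf r) * Φ r)
        = ∫ r, (deriv Φ r * Q r - G r * (- Φ r)) := by
      rw [← integral_indicator measurableSet_Ioi]
      congr 1; ext r
      by_cases hr : 0 < r
      · rw [indicator_of_mem (show r ∈ Ioi 0 from hr), hQpt r hr, hvfv r hr]
        simp only [hG]; ring
      · rw [indicator_of_notMem (by simpa using hr), hQ0 r (not_lt.1 hr), hG0 r (not_lt.1 hr)]; simp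
    rw [h2, integral_sub, ← h1, sub_self]
    · exact (hd.mul hQc).integrable_of_hasCompactSupport hΦs.deriv.mul_right
    · exact hGl.integrable_smul_right_of_hasCompactSupport (g := fun r => - Φ r) hΦ.continuous.neg hΦs.neg

end RadialPart3

section PolarPart
open Set Filter Topology
variable {E : Type*} [NormedAddCommGroup E] [InnerProductSpace ℝ E] [FiniteDimensional ℝ E]
  [MeasurableSpace E] [BorelSpace E] [Nontrivial E]

/-- integration in polar coordinates: vanishing on rays -/
lemma polar_zero (F : E → ℝ) (hF : Integrable F)
    (h0 : ∀ ω : E, ‖ω‖ = 1 →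
      ∫ r in Ioi (0:ℝ), r ^ (Module.finrank ℝ E - 1) * F (r • ω) = 0) :
    ∫ x, F x = 0 := by
  have hmp := (volume : Measure E).measurePreserving_homeomorphUnitSphereProd
  have hme : MeasurableEmbedding (homeomorphUnitSphereProd E) := Homeomorph.measurableEmbedding _
  set g : Metric.sphere (0:E) 1 × Ioi (0:ℝ) → ℝ := fun p => F ((p.2 : ℝ) • (p.1 : E)) with hg
  have hgc : ∀ x : ({0}ᶜ : Set E), g (homeomorphUnitSphereProd E x) = F x := by
    intro x
    simp only [hg]
    congr 1
    have hx : ‖(x : E)‖ ≠ 0 := norm_ne_zero_iff.2 x.2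
    simp only [homeomorphUnitSphereProd_apply_fst_coe, homeomorphUnitSphereProd_apply_snd_coe]
    rw [smul_smul, mul_inv_cancel₀ hx, one_smul]
  have hintg : Integrable g
      ((volume : Measure E).toSphere.prod (Measure.volumeIoiPow (Module.finrank ℝ E - 1))) := by
    rw [← hmp.integrable_comp_emb hme]
    have h1 : IntegrableOn F ({0}ᶜ) := hF.integrableOn
    rw [integrableOn_iff_comap_subtypeVal (by measurability)] at h1
    refine h1.congr (Eventually.of_forall fun x => ?_)
    exact (hgc x).symm
  have h1 : ∫ x, F x = ∫ x : ({0}ᶜ : Set E), F x ∂(Measure.comap (↑) (volume : Measure E)) := by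
    rw [integral_subtype_comap (by measurability), restrict_compl_singleton]
  have h2 : ∫ x : ({0}ᶜ : Set E), F x ∂(Measure.comap (↑) (volume : Measure E))
      = ∫ p, g p ∂((volume : Measure E).toSphere.prod
        (Measure.volumeIoiPow (Module.finrank ℝ E - 1))) := by
    rw [← hmp.integral_comp hme]
    congr 1; ext x; exact (hgc x).symm
  rw [h1, h2, integral_prod _ hintg]
  have h3 : ∀ ω : Metric.sphere (0:E) 1,
      ∫ r, g (ω, r) ∂(Measure.volumeIoiPow (Module.finrank ℝ E - 1)) = 0 := by
    intro ω
    have hω : ‖(ω : E)‖ = 1 := by simp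
    refine Eq.trans ?_ (h0 ω hω)
    rw [← integral_subtype_comap measurableSet_Ioi
      (fun r : ℝ => r ^ (Module.finrank ℝ E - 1) * F (r • (ω : E))), Measure.volumeIoiPow,
      integral_withDensity_eq_integral_toReal_smul]
    · congr 1; ext r
      have : (0:ℝ) < r := r.2
      simp only [hg, smul_eq_mul]
      rw [ENNReal.toReal_ofReal (by positivity)]
    · fun_prop
    · simp
  simp [h3]

end PolarPart

section RadialGrad
open Set Filter Topology
variable {E : Type*} [NormedAddCommGroup E] [InnerProductSpace ℝ E]

/-- gradient of a radial function -/
noncomputable def rgrad (pt : ℝ → ℝ) (x : E) : E := (pt ‖x‖ * ‖x‖⁻¹) • x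

lemma rgrad_hasFDerivAt {vf pt : ℝ → ℝ} (hd : ∀ r, HasDerivAt vf (pt r) r) (h0 : pt 0 = 0) (x : E) :
    HasFDerivAt (fun x : E => vf ‖x‖) (innerSL ℝ (rgrad pt x)) x := by
  by_cases hx : x = 0
  · subst hx
    have h1 := hd 0
    rw [h0, hasDerivAt_iff_isLittleO] at h1
    rw [hasFDerivAt_iff_isLittleO]
    have h2 : Tendsto (fun x : E => ‖x‖) (𝓝 0) (𝓝 0) := by
      simpa using (continuous_norm (E := E)).tendsto 0
    have h3 := h1.comp_tendsto h2
    have : rgrad pt (0:E) = 0 := by simp [rgrad]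
    rw [this]
    refine (h3.congr_left ?_).trans_isBigO ?_
    · intro y; simp
    · simp only [Function.comp_def, sub_zero]
      exact (Asymptotics.isBigO_refl _ _).norm_left
  · have h1 : HasFDerivAt (fun y : E => ‖y‖) (‖x‖⁻¹ • innerSL ℝ x) x := by
      have h2 := ((hasStrictFDerivAt_norm_sq x).hasFDerivAt).sqrt (by simpa using hx)
      have h3 : (fun y : E => √(‖y‖ ^ 2)) = fun y => ‖y‖ := by
        ext y; exact Real.sqrt_sq (norm_nonneg y)
      rw [h3, Real.sqrt_sq (norm_nonneg x)] at h2
      convert h2 using 1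
      ext y
      simp
      ring
    have h4 := (hd ‖x‖).comp_hasFDerivAt x h1
    have h5 : innerSL ℝ (rgrad pt x) = pt ‖x‖ • ‖x‖⁻¹ • innerSL ℝ x := by
      ext y
      simp [rgrad, inner_smul_left, mul_assoc]
    rw [h5]
    exact h4

lemma rgrad_norm {pt : ℝ → ℝ} (h0 : pt 0 = 0) (x : E) : ‖rgrad pt x‖ = |pt ‖x‖| := by
  by_cases hx : x = 0
  · simp [hx, rgrad, h0]
  · have : ‖x‖ ≠ 0 := by simpa using hx
    rw [rgrad, norm_smul, norm_mul, norm_inv, norm_norm, mul_assoc, inv_mul_cancel₀ this, mul_one,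
      Real.norm_eq_abs]

lemma rgrad_cont {pt : ℝ → ℝ} (hc : Continuous pt) (h0 : pt 0 = 0) :
    Continuous (rgrad pt : E → E) := by
  rw [continuous_iff_continuousAt]
  intro x
  by_cases hx : x = 0
  · subst hx
    have : rgrad pt (0:E) = 0 := by simp [rgrad]
    rw [ContinuousAt, this, tendsto_zero_iff_norm_tendsto_zero]
    simp only [rgrad_norm h0]
    have : Continuous fun x : E => |pt ‖x‖| := by fun_prop
    simpa [h0] using this.tendsto 0
  · unfold rgrad
    have : ‖x‖ ≠ 0 := by simpa using hx
    refine ContinuousAt.smul (ContinuousAt.mul ?_ (continuous_norm.continuousAt.inv₀ this)) continuousAt_id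
    exact (hc.comp continuous_norm).continuousAt

end RadialGrad

section Nonlin
open Set

lemma gam_match {q : ℝ} (hq : 4 < q) {γ : ℝ → ℝ}
    (hγ : ∀ s : ℝ, γ s = if 0 < s then s ^ (q - 1) else 0) (s : ℝ) : γ s = gam q s := by
  rw [hγ]
  split_ifs with h1
  · rw [gam, max_eq_left h1.le]
  · rw [gam_of_nonpos q s hq (not_lt.1 h1)]

lemma gamb_match {q a β : ℝ} (hq : 4 < q) (ha : 0 < a) (hβ : β = a ^ (1 / (q - 2))) {γ γbar : ℝ → ℝ}
    (hγ : ∀ s : ℝ, γ s = if 0 < s then s ^ (q - 1) else 0)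
    (hγbar : ∀ s : ℝ, γbar s = if s ≤ β then γ s else a * s) (s : ℝ) : γbar s = gamb q a s := by
  have hq2 : 0 < q - 2 := by linarith
  have hβ0 : 0 < β := by rw [hβ]; exact Real.rpow_pos_of_pos ha _
  have hβq : β ^ (q - 2) = a := by
    rw [hβ, ← Real.rpow_mul ha.le, one_div_mul_cancel hq2.ne', Real.rpow_one]
  rw [hγbar, gam_match hq hγ]
  rcases le_or_gt s 0 with hs | hs
  · rw [if_pos (hs.trans hβ0.le), gam_of_nonpos q s hq hs, gamb_of_nonpos q a s hq hs]
  · rw [gamb_of_pos q a s hs]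
    split_ifs with h1
    · rw [gam_of_pos q s hs, min_eq_left]
      rw [← hβq]; exact Real.rpow_le_rpow hs.le h1 hq2.le
    · rw [min_eq_right]
      rw [← hβq]; exact Real.rpow_le_rpow hβ0.le (not_le.1 h1).le hq2.le

end Nonlin

/-- Existence of a nontrivial critical point of the truncated functional (Theorem 3.2,
weak formulation): there is a radial, not a.e. zero function `v` with weak gradient
`g ∈ L²` and `∫ V f(v)² < ∞` such that
`∫ ∇v·∇φ + ∫ V f(v) f'(v) φ − ∫ w(x, f(v)) f'(v) φ = 0` for all test functions `φ`,
where `f'(v) = 1/√(1 + f(v)²)`. -/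
theorem stmt_18 (N : ℕ) (hN : 2 < N) (twoStar q : ℝ)
    (h2s : twoStar = 2 * N / (N - 2)) (hq : q = 2 * twoStar)
    (θ k α β : ℝ) (hθ₁ : 4 < θ) (hθ₂ : θ < q) (hk : θ / (θ - 2) < k) (hα : 0 < α)
    (hβ : β = (α / k) ^ (1 / (2 * (twoStar - 1))))
    (f : ℝ → ℝ) (hf₁ : Function.LeftInverse f h) (hf₂ : Function.RightInverse f h)
    (R₁ r₁ r₂ R₂ : ℝ) (hR₁ : 0 < R₁) (hr₁ : R₁ < r₁) (hr₂ : r₁ < r₂) (hR₂ : r₂ < R₂)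
    (Ω Λ : Set (EuclideanSpace ℝ (Fin N)))
    (hΩ : Ω = {x : EuclideanSpace ℝ (Fin N) | r₁ < ‖x‖ ∧ ‖x‖ < r₂})
    (hΛ : Λ = {x : EuclideanSpace ℝ (Fin N) | R₁ < ‖x‖ ∧ ‖x‖ < R₂})
    (V : EuclideanSpace ℝ (Fin N) → ℝ) (hVcont : Continuous V)
    (hVrad : ∀ x y : EuclideanSpace ℝ (Fin N), ‖x‖ = ‖y‖ → V x = V y)
    (hV₀ : ∀ x, 0 ≤ V x) (hVΩ : ∀ x ∈ Ω, V x = 0) (hVα : ∀ x, x ∉ Λ → α ≤ V x)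
    (γ : ℝ → ℝ) (hγ : ∀ s : ℝ, γ s = if 0 < s then s ^ (q - 1) else 0)
    (γbar : ℝ → ℝ) (hγbar : ∀ s : ℝ, γbar s = if s ≤ β then γ s else (α / k) * s)
    (w : EuclideanSpace ℝ (Fin N) → ℝ → ℝ)
    (hw : ∀ x s, w x s = if x ∈ Λ then γ s else γbar s) :
    ∃ (v : EuclideanSpace ℝ (Fin N) → ℝ)
      (g : EuclideanSpace ℝ (Fin N) → EuclideanSpace ℝ (Fin N)),
      Measurable v ∧
      (∀ x y : EuclideanSpace ℝ (Fin N), ‖x‖ = ‖y‖ → v x = v y) ∧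
      ¬ (v =ᵐ[volume] fun _ => 0) ∧
      Integrable (fun x => ‖g x‖ ^ 2) ∧
      (∀ (φ : EuclideanSpace ℝ (Fin N) → ℝ), ContDiff ℝ (⊤ : ℕ∞) φ → HasCompactSupport φ →
        ∀ i : Fin N,
          ∫ x, v x * fderiv ℝ φ x (EuclideanSpace.single i 1)
            = -∫ x, g x i * φ x) ∧
      Integrable (fun x => V x * f (v x) ^ 2) ∧
      (∀ (φ : EuclideanSpace ℝ (Fin N) → ℝ), ContDiff ℝ (⊤ : ℕ∞) φ → HasCompactSupport φ →
        (∫ x, (inner ℝ (g x) (gradient φ x) : ℝ))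
            + (∫ x, V x * f (v x) * (1 / Real.sqrt (1 + f (v x) ^ 2)) * φ x)
            - (∫ x, w x (f (v x)) * (1 / Real.sqrt (1 + f (v x) ^ 2)) * φ x) = 0) := by
  have hq4 : 4 < q := hθ₁.trans hθ₂
  have hk1 : 1 < k := by
    refine lt_trans ?_ hk
    rw [lt_div_iff₀ (by linarith)]
    linarith
  have hk0 : 0 < k := by linarith
  have ha : 0 < α / k := by positivity
  have hgam := gam_match hq4 hγ
  have hgamb := gamb_match hq4 ha (β := β) (by rw [hβ, hq]; congr 2; ring) hγ hγbar
  have hΛm : ∀ x, x ∈ Λ ↔ ‖x‖ ∈ Set.Ioo R₁ R₂ := by intro x; rw [hΛ]; rfl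
  have hΛo : IsOpen Λ := by
    have : Λ = (fun x : EuclideanSpace ℝ (Fin N) => ‖x‖) ⁻¹' Set.Ioo R₁ R₂ := by
      ext x; exact hΛm x
    rw [this]; exact isOpen_Ioo.preimage continuous_norm
  have hfin : Module.finrank ℝ (EuclideanSpace ℝ (Fin N)) - 1 = N - 1 := by simp
  have : Nontrivial (EuclideanSpace ℝ (Fin N)) := by
    have : Nonempty (Fin N) := ⟨⟨0, by omega⟩⟩
    infer_instance
  set e : EuclideanSpace ℝ (Fin N) := EuclideanSpace.single ⟨0, by omega⟩ 1 with he
  have hen : ‖e‖ = 1 := by simp [he]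
  have hre : ∀ r : ℝ, 0 ≤ r → ‖r • e‖ = r := by
    intro r hr; rw [norm_smul, hen, mul_one, Real.norm_of_nonneg hr]
  set Vr : ℝ → ℝ := fun r => V (r • e) with hVr
  have hVx : ∀ x, V x = Vr ‖x‖ := fun x => hVrad _ _ (hre _ (norm_nonneg x)).symm
  have H : RadHyp (N - 1) f q (α / k) R₁ R₂ Vr := by
    refine ⟨by omega, hf₁, hf₂, hq4, ha, hR₁, by linarith, by fun_prop, fun r => hV₀ _,
      1 - 1 / k, ?_, ?_⟩
    · have : 1 / k < 1 := by rw [div_lt_one hk0]; exact hk1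
      linarith
    · intro r hr hr2
      have h1 : α ≤ Vr r := hVα _ (by rw [hΛm, hre r hr]; exact hr2)
      have h2 : α / k ≤ Vr r / k := by gcongr
      have h3 : (1 - 1 / k) * Vr r = Vr r - Vr r / k := by ring
      linarith
  obtain ⟨vf, pt, hd, hptc, hpt0, ⟨r₀, hr₀, hvr₀⟩, hi1, hi2, hEL⟩ := H.radial_exists
  have hp0 := hpt0 0 le_rfl
  have hvfc : Continuous vf := continuous_iff_continuousAt.2 fun r => (hd r).continuousAt
  have hfc := f_cont hf₁ hf₂
  have hvc : Continuous fun x : EuclideanSpace ℝ (Fin N) => vf ‖x‖ := hvfc.comp continuous_norm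
  have hgc : Continuous (rgrad pt : EuclideanSpace ℝ (Fin N) → EuclideanSpace ℝ (Fin N)) :=
    rgrad_cont hptc hp0
  have hder := fun x : EuclideanSpace ℝ (Fin N) => rgrad_hasFDerivAt hd hp0 x
  refine ⟨fun x => vf ‖x‖, rgrad pt, hvc.measurable, fun x y hxy => by simp only [hxy],
    ?_, ?_, ?_, ?_, ?_⟩
  · intro hae
    have := (Continuous.ae_eq_iff_eq volume hvc continuous_const).1 hae
    have h1 := congrFun this (r₀ • e)
    simp only [hre r₀ (by linarith [hr₀.1])] at h1
    linarith
  · simp only [rgrad_norm hp0, sq_abs]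
    rw [integrable_fun_norm_addHaar volume (f := fun r => pt r ^ 2), hfin]
    exact hi1
  · intro φ hφ hφs i
    have hφ1 : ContDiff ℝ 1 φ := hφ.of_le (by exact_mod_cast le_top)
    have hdφ : Continuous fun x => fderiv ℝ φ x (EuclideanSpace.single i 1) :=
      (hφ1.continuous_fderiv one_ne_zero).clm_apply continuous_const
    have hfd : ∀ x, fderiv ℝ (fun x : EuclideanSpace ℝ (Fin N) => vf ‖x‖) x
        (EuclideanSpace.single i 1) = rgrad pt x i := by
      intro x
      rw [(hder x).fderiv]
      simp [EuclideanSpace.inner_single_right]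
    have hgi : Continuous fun x : EuclideanSpace ℝ (Fin N) => rgrad pt x i := by fun_prop
    have := integral_mul_fderiv_eq_neg_fderiv_mul_of_integrable (μ := volume)
      (f := fun x : EuclideanSpace ℝ (Fin N) => vf ‖x‖) (g := φ) (v := EuclideanSpace.single i 1)
      (by simp only [hfd]
          exact (hgi.mul hφ1.continuous).integrable_of_hasCompactSupport hφs.mul_left)
      ((hvc.mul hdφ).integrable_of_hasCompactSupport
        (HasCompactSupport.mul_left (hφs.fderiv_apply ℝ _)))
      ((hvc.mul hφ1.continuous).integrable_of_hasCompactSupport hφs.mul_left)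
      (fun x _ => (hder x).differentiableAt)
      (fun x _ => hφ1.differentiable one_ne_zero x)
    rw [this]
    simp only [hfd]
  · simp only [hVx]
    rw [integrable_fun_norm_addHaar volume (f := fun r => Vr r * f (vf r) ^ 2), hfin]
    exact hi2
  · intro φ hφ hφs
    have hφ1 : ContDiff ℝ 1 φ := hφ.of_le (by exact_mod_cast le_top)
    have hφc := hφ1.continuous
    have hin : ∀ x y, inner ℝ y (gradient φ x) = fderiv ℝ φ x y := by
      intro x y
      rw [gradient, real_inner_comm, InnerProductSpace.toDual_symm_apply]
    have hsq : Continuous fun x : EuclideanSpace ℝ (Fin N) => 1 / √(1 + f (vf ‖x‖) ^ 2) := by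
      refine continuous_const.div ?_ ?_
      · have : Continuous fun x : EuclideanSpace ℝ (Fin N) => f (vf ‖x‖) := hfc.comp hvc
        fun_prop
      · intro x; positivity
    have hfv : Continuous fun x : EuclideanSpace ℝ (Fin N) => f (vf ‖x‖) := hfc.comp hvc
    have I1 : Integrable fun x => inner ℝ (rgrad pt x) (gradient φ x) := by
      simp only [hin]
      refine Continuous.integrable_of_hasCompactSupport
        ((hφ1.continuous_fderiv one_ne_zero).clm_apply hgc) ?_
      refine (hφs.fderiv ℝ).mono ?_
      intro x hx hx2
      apply hx
      simp only [hx2]; rfl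
    have I2 : Integrable fun x => V x * f (vf ‖x‖) * (1 / √(1 + f (vf ‖x‖) ^ 2)) * φ x :=
      (((hVcont.mul hfv).mul hsq).mul hφc).integrable_of_hasCompactSupport hφs.mul_left
    have I3 : Integrable fun x => w x (f (vf ‖x‖)) * (1 / √(1 + f (vf ‖x‖) ^ 2)) * φ x := by
      have J1 : Integrable fun x => gam q (f (vf ‖x‖)) * (1 / √(1 + f (vf ‖x‖) ^ 2)) * φ x :=
        ((((gam_cont q hq4).comp hfv).mul hsq).mul hφc).integrable_of_hasCompactSupport hφs.mul_left
      have J2 : Integrable fun x =>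
          gamb q (α / k) (f (vf ‖x‖)) * (1 / √(1 + f (vf ‖x‖) ^ 2)) * φ x :=
        ((((gamb_cont q (α / k) hq4).comp hfv).mul hsq).mul hφc).integrable_of_hasCompactSupport
          hφs.mul_left
      refine (Integrable.piecewise hΛo.measurableSet J1.integrableOn J2.integrableOn).congr
        (Filter.Eventually.of_forall fun x => ?_)
      simp only [Set.piecewise, hw, hgam, hgamb]
      split_ifs <;> rfl
    have hsum := integral_sub (I1.add I2) I3
    rw [integral_add' I1 I2] at hsum
    refine hsum.symm.trans ?_
    refine polar_zero _ ((I1.add I2).sub I3) ?_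
    intro ω hω
    have hΦ : ContDiff ℝ 1 fun r : ℝ => φ (r • ω) := hφ1.comp (contDiff_id.smul contDiff_const)
    have hω0 : ω ≠ 0 := by intro h; simp [h] at hω
    have hΦs : HasCompactSupport fun r : ℝ => φ (r • ω) :=
      hφs.comp_isClosedEmbedding (isClosedEmbedding_smul_left hω0)
    refine Eq.trans ?_ (hEL _ hΦ hΦs)
    rw [hfin]
    refine setIntegral_congr_fun measurableSet_Ioi fun r hr => ?_
    have hr0 : 0 < r := hr
    have hn : ‖r • ω‖ = r := by rw [norm_smul, hω, mul_one, Real.norm_of_nonneg hr0.le]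
    have hdΦ : deriv (fun r : ℝ => φ (r • ω)) r = fderiv ℝ φ (r • ω) ω := by
      have h1 : HasDerivAt (fun r : ℝ => r • ω) ω r := by
        simpa using (hasDerivAt_id r).smul_const ω
      exact ((hφ1.differentiable one_ne_zero (r • ω)).hasFDerivAt.comp_hasDerivAt r h1).deriv
    have hrg : rgrad pt (r • ω) = pt r • ω := by
      rw [rgrad, hn, smul_smul, mul_assoc, inv_mul_cancel₀ hr0.ne', mul_one]
    simp only [Pi.add_apply, Pi.sub_apply, hin, hrg, hn, hdΦ, hVx, map_smul, smul_eq_mul, hw, hΛm, FF',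
      wt_of_pos _ r hr0, pot', hgam, hgamb]
    split_ifs <;> ring
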